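/- arXiv:0705.0992 — 2 statements merged into one kernel-verified Lean document; each statement's English description precedes it below -/
import Mathlib

section
/- Assume the continuum hypothesis (2^{ℵ₀} = ℵ₁). Then every infinite-dimensional factor N acting on a separable Hilbert space (equivalently, every separably represented factor of type I_∞, II, or III) admits a classically normal, singular pure state. -/
open scoped ComplexOrder InnerProductSpace
open Filter Topology

noncomputable instance {H : Type*} [NormedAddCommGroup H] [InnerProductSpace ℂ H]
    [CompleteSpace H] : SMulMemClass (VonNeumannAlgebra H) ℂ (H →L[ℂ] H) :=
  ⟨fun {s} c {_} hx => s.toStarSubalgebra.smul_mem hx c⟩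

/-- The σ-weak (ultraweak, weak*) topology on `B(H)`: the initial topology induced by the
functionals `x ↦ ∑' n, ⟪ξ n, x (η n)⟫` over all pairs of square-summable sequences. -/
noncomputable def sigmaWeak (H : Type*) [NormedAddCommGroup H] [InnerProductSpace ℂ H]
    [CompleteSpace H] : TopologicalSpace (H →L[ℂ] H) :=
  ⨅ (ξ : ℕ → H) (η : ℕ → H) (_ : Summable fun n => ‖ξ n‖ ^ 2)
    (_ : Summable fun n => ‖η n‖ ^ 2),
    TopologicalSpace.induced (fun x : H →L[ℂ] H => ∑' n, ⟪ξ n, x (η n)⟫_ℂ) inferInstance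

variable {H : Type*} [NormedAddCommGroup H] [InnerProductSpace ℂ H] [CompleteSpace H]

/-- A positive linear functional on a von Neumann algebra. -/
def IsPosFunctional (M : VonNeumannAlgebra H) (f : ↥M →ₗ[ℂ] ℂ) : Prop :=
  ∀ a : ↥M, 0 ≤ f (star a * a)

/-- A state on a von Neumann algebra: a positive linear functional sending `1` to `1`. -/
def IsStateOn (M : VonNeumannAlgebra H) (f : ↥M →ₗ[ℂ] ℂ) : Prop :=
  IsPosFunctional M f ∧ f 1 = 1

/-- A pure state: a state such that every positive linear functional it dominates is a
nonnegative scalar multiple of it. -/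
def IsPureStateOn (M : VonNeumannAlgebra H) (f : ↥M →ₗ[ℂ] ℂ) : Prop :=
  IsStateOn M f ∧ ∀ g : ↥M →ₗ[ℂ] ℂ, IsPosFunctional M g → IsPosFunctional M (f - g) →
    ∃ t : ℝ, 0 ≤ t ∧ g = (t : ℂ) • f

/-- A functional on a von Neumann algebra is normal if it is continuous for the σ-weak
topology. -/
def IsNormalOn (M : VonNeumannAlgebra H) (f : ↥M →ₗ[ℂ] ℂ) : Prop :=
  @Continuous ↥M ℂ
    (TopologicalSpace.induced (fun x : ↥M => (x : H →L[ℂ] H)) (sigmaWeak H)) _ f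

/-- A state on a von Neumann algebra is singular if the only normal positive linear
functional it dominates is `0`. -/
def IsSingularOn (M : VonNeumannAlgebra H) (f : ↥M →ₗ[ℂ] ℂ) : Prop :=
  ∀ g : ↥M →ₗ[ℂ] ℂ, IsPosFunctional M g → IsPosFunctional M (f - g) → IsNormalOn M g → g = 0

/-- A projection: a self-adjoint idempotent. -/
def IsProjection (p : H →L[ℂ] H) : Prop := star p = p ∧ p * p = p

/-- `q` is a subprojection of `p` (i.e. `q ≤ p` for projections). -/
def ProjLE (q p : H →L[ℂ] H) : Prop := q * p = q ∧ p * q = q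

/-- `p` is a minimal projection of the set `S`: a nonzero projection in `S` such that the
only projections of `S` below `p` are `0` and `p`. -/
def IsMinimalProjectionIn (S : Set (H →L[ℂ] H)) (p : H →L[ℂ] H) : Prop :=
  p ∈ S ∧ IsProjection p ∧ p ≠ 0 ∧
    ∀ q ∈ S, IsProjection q → ProjLE q p → q = 0 ∨ q = p

/-- `f` is multiplicative on the subset `C` of `M`. -/
def IsMultiplicativeOn (M : VonNeumannAlgebra H) (f : ↥M →ₗ[ℂ] ℂ)
    (C : Set (H →L[ℂ] H)) : Prop :=
  ∀ a b : ↥M, (a : H →L[ℂ] H) ∈ C → (b : H →L[ℂ] H) ∈ C → f (a * b) = f a * f b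

/-- `f` is normal on the von Neumann subalgebra `C` of `M` (where `C ⊆ M`): the restriction
of `f` to `C` is σ-weakly continuous. -/
def IsNormalOnSub (M : VonNeumannAlgebra H) (f : ↥M →ₗ[ℂ] ℂ) (C : VonNeumannAlgebra H)
    (hC : (C : Set (H →L[ℂ] H)) ⊆ M) : Prop :=
  @Continuous ↥C ℂ
    (TopologicalSpace.induced (fun x : ↥C => (x : H →L[ℂ] H)) (sigmaWeak H)) _
    (fun x => f ⟨x, hC x.2⟩)

/-- A state on `M` is classically normal if it is normal on every von Neumann subalgebra
of `M` (with the same unit) on which it is multiplicative. -/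
def IsClassicallyNormalOn (M : VonNeumannAlgebra H) (f : ↥M →ₗ[ℂ] ℂ) : Prop :=
  ∀ (C : VonNeumannAlgebra H) (hC : (C : Set (H →L[ℂ] H)) ⊆ M),
    IsMultiplicativeOn M f (C : Set (H →L[ℂ] H)) → IsNormalOnSub M f C hC

/-- A von Neumann algebra is a factor if its center consists of the scalar multiples of
the identity. -/
def IsFactor (N : VonNeumannAlgebra H) : Prop :=
  ∀ x ∈ N, (∀ y ∈ N, x * y = y * x) → ∃ c : ℂ, x = c • (1 : H →L[ℂ] H)

/-- A positive operator on a Hilbert space. -/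
def IsPositiveOp (a : H →L[ℂ] H) : Prop :=
  star a = a ∧ ∀ v : H, 0 ≤ ⟪v, a v⟫_ℂ

/-! ### Projections and quadratic forms -/

/-- The real quadratic form of a bounded operator. -/
noncomputable def quadForm (x : H →L[ℂ] H) (ξ : H) : ℝ := (⟪ξ, x ξ⟫_ℂ).re

namespace IsProjection

variable {p q : H →L[ℂ] H}

theorem inner_apply (hp : IsProjection p) (ξ η : H) : ⟪p ξ, η⟫_ℂ = ⟪ξ, p η⟫_ℂ := by
  conv_lhs => rw [← hp.1, ContinuousLinearMap.star_eq_adjoint]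
  exact ContinuousLinearMap.adjoint_inner_left p η ξ

theorem apply_apply (hp : IsProjection p) (ξ : H) : p (p ξ) = p ξ :=
  DFunLike.congr_fun hp.2 ξ

theorem one_sub (hp : IsProjection p) : IsProjection (1 - p) := by
  refine ⟨by simp [hp.1], ?_⟩
  rw [sub_mul, mul_sub, mul_sub, hp.2]; simp

theorem norm_sq_add (hp : IsProjection p) (ξ : H) :
    ‖p ξ‖ ^ 2 + ‖(1 - p) ξ‖ ^ 2 = ‖ξ‖ ^ 2 := by
  have h : ⟪p ξ, (1 - p) ξ⟫_ℂ = 0 := by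
    rw [hp.inner_apply]
    simp [hp.apply_apply]
  have h2 := norm_add_sq_eq_norm_sq_add_norm_sq_of_inner_eq_zero (𝕜 := ℂ) _ _ h
  have h3 : p ξ + (1 - p) ξ = ξ := by simp
  rw [h3] at h2
  nlinarith

theorem norm_apply_le (hp : IsProjection p) (ξ : H) : ‖p ξ‖ ≤ ‖ξ‖ := by
  have := hp.norm_sq_add ξ
  exact le_of_sq_le_sq (by nlinarith [sq_nonneg ‖(1 - p) ξ‖]) (norm_nonneg _)

theorem norm_le_one (hp : IsProjection p) : ‖p‖ ≤ 1 :=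
  ContinuousLinearMap.opNorm_le_bound _ zero_le_one fun ξ => by simpa using hp.norm_apply_le ξ

theorem quadForm_self (hp : IsProjection p) (ξ : H) : quadForm p ξ = ‖p ξ‖ ^ 2 := by
  have h : ⟪ξ, p ξ⟫_ℂ = ⟪p ξ, p ξ⟫_ℂ := by rw [hp.inner_apply, hp.apply_apply]
  rw [quadForm, h, norm_sq_eq_re_inner (𝕜 := ℂ) (p ξ)]
  rfl

theorem exists_apply_ne_zero (hp0 : p ≠ 0) : ∃ ξ, p ξ ≠ 0 := by
  by_contra! h
  exact hp0 (ContinuousLinearMap.ext h)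

/-- If `q ≤ p` then `p - q` is a projection. -/
theorem sub (hp : IsProjection p) (hq : IsProjection q) (h : q * p = q) (h' : p * q = q) :
    IsProjection (p - q) := by
  refine ⟨by simp [hp.1, hq.1], ?_⟩
  rw [sub_mul, mul_sub, mul_sub, hp.2, hq.2, h, h']; simp

theorem mul_eq_of_mul_eq (hp : IsProjection p) (hq : IsProjection q) (h : p * q = q) :
    q * p = q := by
  have := congrArg star h
  rwa [star_mul, hp.1, hq.1] at this

theorem add (hp : IsProjection p) (hq : IsProjection q) (h : p * q = 0) :
    IsProjection (p + q) := by
  have h' : q * p = 0 := by simpa [hp.1, hq.1] using congrArg star h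
  refine ⟨by simp [hp.1, hq.1], ?_⟩
  rw [add_mul, mul_add, mul_add, hp.2, hq.2, h, h']; simp

theorem zero : IsProjection (0 : H →L[ℂ] H) := ⟨by simp, by simp⟩

theorem one : IsProjection (1 : H →L[ℂ] H) := ⟨by simp, by simp⟩

end IsProjection

theorem abs_quadForm_le (x : H →L[ℂ] H) (ξ : H) : |quadForm x ξ| ≤ ‖x‖ * ‖ξ‖ ^ 2 := by
  calc |quadForm x ξ| ≤ ‖⟪ξ, x ξ⟫_ℂ‖ := Complex.abs_re_le_norm _
    _ ≤ ‖ξ‖ * ‖x ξ‖ := norm_inner_le_norm _ _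
    _ ≤ ‖ξ‖ * (‖x‖ * ‖ξ‖) := by gcongr; exact x.le_opNorm ξ
    _ = _ := by ring

/-- The quadratic form changes little under a small perturbation of the vector. -/
theorem abs_quadForm_sub_le (x : H →L[ℂ] H) {a η : H} {t : ℝ} (ha : ‖a‖ ≤ ‖η‖)
    (hc : ‖η - a‖ ≤ t * ‖η‖) : |quadForm x η - quadForm x a| ≤ 2 * ‖x‖ * t * ‖η‖ ^ 2 := by
  have h1 : quadForm x η - quadForm x a = (⟪η - a, x η⟫_ℂ + ⟪a, x (η - a)⟫_ℂ).re := by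
    simp [quadForm]
  have e1 : ‖⟪η - a, x η⟫_ℂ‖ ≤ (t * ‖η‖) * (‖x‖ * ‖η‖) :=
    (norm_inner_le_norm _ _).trans
      (mul_le_mul hc (x.le_opNorm η) (norm_nonneg _) ((norm_nonneg _).trans hc))
  have e2 : ‖⟪a, x (η - a)⟫_ℂ‖ ≤ ‖η‖ * (‖x‖ * (t * ‖η‖)) :=
    (norm_inner_le_norm _ _).trans (by gcongr; exact (x.le_opNorm _).trans (by gcongr))
  rw [h1]
  calc _ ≤ ‖⟪η - a, x η⟫_ℂ + ⟪a, x (η - a)⟫_ℂ‖ := Complex.abs_re_le_norm _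
    _ ≤ _ := norm_add_le _ _
    _ ≤ _ := add_le_add e1 e2
    _ = _ := by ring

theorem quadForm_sub_smul_one (x : H →L[ℂ] H) (c : ℝ) (ξ : H) :
    quadForm (x - (c : ℂ) • 1) ξ = quadForm x ξ - c * ‖ξ‖ ^ 2 := by
  have h : (⟪ξ, ξ⟫_ℂ).re = ‖ξ‖ ^ 2 := (norm_sq_eq_re_inner (𝕜 := ℂ) ξ).symm
  simp [quadForm, -inner_self_eq_norm_sq_to_K, h]

/-- An operator whose quadratic form is small is small, for self-adjoint operators. -/
theorem norm_le_of_abs_quadForm_le {x : H →L[ℂ] H} (hx : star x = x) {c : ℝ} (hc : 0 ≤ c)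
    (h : ∀ ξ, |quadForm x ξ| ≤ c * ‖ξ‖ ^ 2) : ‖x‖ ≤ c := by
  refine x.opNorm_le_bound hc fun ξ => ?_
  have hsymm : ∀ a b : H, ⟪x a, b⟫_ℂ = ⟪a, x b⟫_ℂ := fun a b => by
    conv_lhs => rw [← hx, ContinuousLinearMap.star_eq_adjoint]
    exact ContinuousLinearMap.adjoint_inner_left x b a
  have polar : ∀ η, quadForm x (ξ + η) - quadForm x (ξ - η) = 4 * (⟪η, x ξ⟫_ℂ).re := by
    intro η
    have h1 : (⟪ξ, x η⟫_ℂ).re = (⟪η, x ξ⟫_ℂ).re := by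
      rw [← hsymm]; exact inner_re_symm (𝕜 := ℂ) _ _
    simp only [quadForm, map_add, map_sub, inner_add_left, inner_add_right, inner_sub_left,
      inner_sub_right, Complex.add_re, Complex.sub_re, h1]
    ring
  by_cases h0 : ‖x ξ‖ = 0
  · rw [h0]; positivity
  have hpos : 0 < ‖x ξ‖ := lt_of_le_of_ne (norm_nonneg _) (Ne.symm h0)
  by_cases hξ : ‖ξ‖ = 0
  · rw [norm_eq_zero] at hξ; simp [hξ]
  have hξpos : 0 < ‖ξ‖ := lt_of_le_of_ne (norm_nonneg _) (Ne.symm hξ)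
  set s : ℝ := ‖ξ‖ / ‖x ξ‖ with hs
  have hp := polar ((s : ℂ) • x ξ)
  have hn : (⟪(s : ℂ) • x ξ, x ξ⟫_ℂ).re = s * ‖x ξ‖ ^ 2 := by
    have h : (⟪x ξ, x ξ⟫_ℂ).re = ‖x ξ‖ ^ 2 := (norm_sq_eq_re_inner (𝕜 := ℂ) _).symm
    simp [-inner_self_eq_norm_sq_to_K, h]
  have hη : ‖(s : ℂ) • x ξ‖ = ‖ξ‖ := by
    rw [norm_smul, Complex.norm_real, Real.norm_of_nonneg (by positivity), hs]
    field_simp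
  have hpar := parallelogram_law_with_norm ℂ ξ ((s : ℂ) • x ξ)
  have b1 := (abs_le.1 (h (ξ + (s : ℂ) • x ξ))).2
  have b2 := (abs_le.1 (h (ξ - (s : ℂ) • x ξ))).1
  rw [hn] at hp
  rw [hη] at hpar
  have hs2 : s * ‖x ξ‖ ^ 2 = ‖ξ‖ * ‖x ξ‖ := by rw [hs]; field_simp
  rw [hs2] at hp
  have : ‖ξ‖ * ‖x ξ‖ ≤ ‖ξ‖ * (c * ‖ξ‖) := by nlinarith
  exact le_of_mul_le_mul_left this hξpos

/-! ### Membership in von Neumann algebras -/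

theorem VonNeumannAlgebra.mem_of_commute (N : VonNeumannAlgebra H) {x : H →L[ℂ] H}
    (h : ∀ y ∈ N.commutant, y * x = x * y) : x ∈ N := by
  rw [← N.commutant_commutant, VonNeumannAlgebra.mem_commutant_iff]
  exact h

theorem VonNeumannAlgebra.commute_of_mem (N : VonNeumannAlgebra H) {x y : H →L[ℂ] H}
    (hx : x ∈ N) (hy : y ∈ N.commutant) : x * y = y * x :=
  VonNeumannAlgebra.mem_commutant_iff.1 hy x hx

theorem isProjection_starProjection (K : Submodule ℂ H) [K.HasOrthogonalProjection] :
    IsProjection K.starProjection :=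
  have h := isStarProjection_starProjection (U := K)
  ⟨h.isSelfAdjoint, h.isIdempotentElem⟩

/-- The projection onto the closure of a subspace invariant under the commutant. -/
theorem VonNeumannAlgebra.starProjection_closure_mem (N : VonNeumannAlgebra H)
    (K : Submodule ℂ H) (h : ∀ y ∈ N.commutant, ∀ ξ ∈ K, y ξ ∈ K) :
    K.topologicalClosure.starProjection ∈ N := by
  rw [VonNeumannAlgebra.IsStarProjection.mem_iff isStarProjection_starProjection]
  intro y hy
  rw [Module.End.mem_invtSubmodule]
  intro ξ hξ
  rw [Submodule.range_starProjection] at hξ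
  rw [Submodule.mem_comap, Submodule.range_starProjection]
  exact map_mem_closure (f := fun v => y v) y.continuous hξ (fun v hv => h y hy v hv)

theorem VonNeumannAlgebra.smul_mem' (N : VonNeumannAlgebra H) {x : H →L[ℂ] H} (c : ℂ)
    (hx : x ∈ N) : c • x ∈ N := N.toStarSubalgebra.smul_mem hx c

theorem VonNeumannAlgebra.posPart_mem (N : VonNeumannAlgebra H) {x : H →L[ℂ] H}
    (hx : x ∈ N) : x⁺ ∈ N := by
  refine N.mem_of_commute fun y hy => ?_
  have : Commute x y := N.commute_of_mem hx hy
  exact ((this.cfcₙ_real _).eq).symm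

theorem VonNeumannAlgebra.sqrt_mem (N : VonNeumannAlgebra H) {x : H →L[ℂ] H}
    (hx : x ∈ N) : CFC.sqrt x ∈ N := by
  refine N.mem_of_commute fun y hy => ?_
  have : Commute x y := N.commute_of_mem hx hy
  exact ((this.cfcₙ_nnreal _).eq).symm

/-! ### Spectral projections, minimal projections, and factors -/

theorem opMul_apply (a b : H →L[ℂ] H) (v : H) : (a * b) v = a (b v) := rfl

theorem mul_starProjection_closure_congr {e : H →L[ℂ] H} {K : Submodule ℂ H}
    (he : e = K.topologicalClosure.starProjection) {a b : H →L[ℂ] H}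
    (h : ∀ v ∈ K, a v = b v) : a * e = b * e := by
  ext ξ
  have hm : e ξ ∈ K.topologicalClosure := by
    rw [he]; exact Submodule.starProjection_apply_mem _ _
  exact closure_minimal (s := (K : Set H)) (t := {v | a v = b v}) h
    (isClosed_eq a.continuous b.continuous) hm

theorem inner_star_eq {x : H →L[ℂ] H} (hx : star x = x) (a b : H) :
    ⟪x a, b⟫_ℂ = ⟪a, x b⟫_ℂ := by
  conv_lhs => rw [← hx, ContinuousLinearMap.star_eq_adjoint]
  exact ContinuousLinearMap.adjoint_inner_left x b a

theorem quadForm_nonneg {x : H →L[ℂ] H} (hx : 0 ≤ x) (ξ : H) : 0 ≤ quadForm x ξ := by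
  rw [ContinuousLinearMap.nonneg_iff_isPositive] at hx
  exact hx.re_inner_nonneg_right ξ

/-- The spectral projection of the corner `q x q` for the half-line above `c`. -/
theorem exists_spectral_projection (N : VonNeumannAlgebra H) {q x : H →L[ℂ] H}
    (hq : IsProjection q) (hqN : q ∈ N) (hx : star x = x) (hxN : x ∈ N) (c : ℝ) :
    ∃ e ∈ N, IsProjection e ∧ q * e = e ∧ e * q = e ∧
      (∀ ξ, c * ‖e ξ‖ ^ 2 ≤ quadForm x (e ξ)) ∧
      (∀ ξ, quadForm x ((q - e) ξ) ≤ c * ‖(q - e) ξ‖ ^ 2) ∧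
      ∀ ξ η, ⟪e ξ, x ((q - e) η)⟫_ℂ = 0 := by
  set y : H →L[ℂ] H := x - (c : ℂ) • 1 with hy
  have hys : star y = y := by simp [hy, hx]
  have hyN : y ∈ N := sub_mem hxN (N.smul_mem' _ (one_mem N))
  set T : H →L[ℂ] H := q * y * q with hT
  have hTs : star T = T := by simp [hT, hys, hq.1, mul_assoc]
  have hTN : T ∈ N := mul_mem (mul_mem hqN hyN) hqN
  have hPN : T⁺ ∈ N := N.posPart_mem hTN
  have hdec : T⁺ - T⁻ = T := CFC.posPart_sub_negPart T hTs
  have hPM : T⁺ * T⁻ = 0 := CFC.posPart_mul_negPart T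
  have hMP : T⁻ * T⁺ = 0 := CFC.negPart_mul_posPart T
  have hP0 : 0 ≤ T⁺ := CFC.posPart_nonneg T
  have hM0 : 0 ≤ T⁻ := CFC.negPart_nonneg T
  have hPs : star T⁺ = T⁺ := (IsSelfAdjoint.of_nonneg hP0).star_eq
  have hMs : star T⁻ = T⁻ := (IsSelfAdjoint.of_nonneg hM0).star_eq
  have hqT : q * T = T := by rw [hT, ← mul_assoc, ← mul_assoc, hq.2]
  have hTP : T * T⁺ = T⁺ * T⁺ := by
    have := congrArg (· * T⁺) hdec
    simpa only [sub_mul, hMP, sub_zero] using this.symm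
  have hqP : q * T⁺ = T⁺ := by
    have h1 : q * (T⁺ * T⁺) = T⁺ * T⁺ := by rw [← hTP, ← mul_assoc, hqT]
    have h2 : ((1 - q) * T⁺) * star ((1 - q) * T⁺) = 0 := by
      rw [star_mul, hPs, mul_assoc, ← mul_assoc T⁺, ← mul_assoc, sub_mul, h1]
      simp
    have h3 := (CStarRing.mul_star_self_eq_zero_iff _).1 h2
    rw [sub_mul, one_mul, sub_eq_zero] at h3
    exact h3.symm
  set K : Submodule ℂ H := (T⁺).range with hK
  set e : H →L[ℂ] H := K.topologicalClosure.starProjection with he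
  have hep : IsProjection e := isProjection_starProjection _
  have heN : e ∈ N := by
    refine N.starProjection_closure_mem K ?_
    rintro z hz _ ⟨v, rfl⟩
    exact ⟨z v, DFunLike.congr_fun (N.commute_of_mem hPN hz) v⟩
  have heP : e * T⁺ = T⁺ := by
    ext v
    exact Submodule.starProjection_eq_self_iff.2 (Submodule.le_topologicalClosure _ ⟨v, rfl⟩)
  have hPe : T⁺ * e = T⁺ := by
    have := congrArg star heP
    rwa [star_mul, hep.1, hPs] at this
  have hqe : q * e = e := by
    rw [mul_starProjection_closure_congr (b := 1) he, one_mul]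
    rintro _ ⟨v, rfl⟩
    exact DFunLike.congr_fun hqP v
  have heq : e * q = e := hq.mul_eq_of_mul_eq hep hqe
  have hMe : T⁻ * e = 0 := by
    rw [mul_starProjection_closure_congr (b := 0) he, zero_mul]
    rintro _ ⟨v, rfl⟩
    exact DFunLike.congr_fun hMP v
  have hqy : ∀ a b : H, q a = a → q b = b → ⟪a, y b⟫_ℂ = ⟪a, T b⟫_ℂ := by
    intro a b ha hb
    simp only [hT, opMul_apply, hb]
    conv_lhs => rw [← ha, hq.inner_apply]
  have hqv : ∀ ξ, q ((q - e) ξ) = (q - e) ξ := fun ξ => by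
    simp [hq.apply_apply, show q (e ξ) = e ξ from DFunLike.congr_fun hqe ξ]
  have hev : ∀ ξ, e ((q - e) ξ) = 0 := fun ξ => by
    simp [hep.apply_apply, show e (q ξ) = e ξ from DFunLike.congr_fun heq ξ]
  have hPv : ∀ ξ, T⁺ ((q - e) ξ) = 0 := fun ξ => by
    have := DFunLike.congr_fun hPe ((q - e) ξ)
    rw [← this, opMul_apply, hev, map_zero]
  have hTa : ∀ v, T v = T⁺ v - T⁻ v := fun v => (DFunLike.congr_fun hdec v).symm
  refine ⟨e, heN, hep, hqe, heq, fun ξ => ?_, fun ξ => ?_, fun ξ η => ?_⟩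
  · have h1 : quadForm y (e ξ) = quadForm T⁺ (e ξ) := by
      have hqq : q (e ξ) = e ξ := DFunLike.congr_fun hqe ξ
      rw [quadForm, hqy _ _ hqq hqq, hTa,
        show T⁻ (e ξ) = 0 from DFunLike.congr_fun hMe ξ, sub_zero, quadForm]
    have h2 := quadForm_nonneg hP0 (e ξ)
    rw [← h1, hy, quadForm_sub_smul_one] at h2
    linarith
  · have h1 : quadForm y ((q - e) ξ) = - quadForm T⁻ ((q - e) ξ) := by
      rw [quadForm, hqy _ _ (hqv ξ) (hqv ξ), hTa, hPv, zero_sub, quadForm, inner_neg_right,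
        Complex.neg_re]
    have h2 := quadForm_nonneg hM0 ((q - e) ξ)
    rw [hy, quadForm_sub_smul_one] at h1
    linarith
  · have h0 : ⟪e ξ, (q - e) η⟫_ℂ = 0 := by rw [hep.inner_apply, hev, inner_zero_right]
    have h1 : ⟪e ξ, y ((q - e) η)⟫_ℂ = ⟪e ξ, x ((q - e) η)⟫_ℂ := by
      rw [hy, sub_apply, inner_sub_right, smul_apply, one_apply_eq_self, inner_smul_right, h0,
        mul_zero, sub_zero]
    rw [← h1, hqy (e ξ) _ (DFunLike.congr_fun hqe ξ) (hqv η), hTa, hPv, zero_sub, inner_neg_right,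
      ← inner_star_eq hMs, show T⁻ (e ξ) = 0 from DFunLike.congr_fun hMe ξ, inner_zero_left,
      neg_zero]

theorem exists_eq_smul_of_minimal_of_star_eq (C : VonNeumannAlgebra H) {q : H →L[ℂ] H}
    (hq : IsMinimalProjectionIn (C : Set (H →L[ℂ] H)) q) {x : H →L[ℂ] H} (hx : x ∈ C)
    (hxs : star x = x) : ∃ c : ℂ, q * x * q = c • q := by
  obtain ⟨hqC, hqp, hq0, hmin⟩ := hq
  obtain ⟨ξ₀, hξ₀⟩ := IsProjection.exists_apply_ne_zero hq0
  set v := q ξ₀ with hv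
  have hvpos : 0 < ‖v‖ ^ 2 := by positivity
  set c : ℝ := quadForm x v / ‖v‖ ^ 2 with hc
  have hcv : quadForm x v = c * ‖v‖ ^ 2 := by rw [hc]; field_simp
  have key : ∀ d : ℝ, (∀ ξ, d * ‖q ξ‖ ^ 2 ≤ quadForm x (q ξ)) ∨
      (∀ ξ, quadForm x (q ξ) ≤ d * ‖q ξ‖ ^ 2) := by
    intro d
    obtain ⟨e, heC, hep, hqe, heq, h1, h2, -⟩ := exists_spectral_projection C hqp hqC hxs hx d
    rcases hmin e heC hep ⟨heq, hqe⟩ with rfl | rfl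
    · right; simpa using h2
    · left; exact h1
  have hall : ∀ ξ, quadForm x (q ξ) = c * ‖q ξ‖ ^ 2 := by
    intro ξ
    refine le_antisymm ?_ ?_
    · refine le_of_forall_pos_le_add fun ε hε => ?_
      have hd : 0 < ε / (‖q ξ‖ ^ 2 + 1) := by positivity
      have hd' : ε / (‖q ξ‖ ^ 2 + 1) * ‖q ξ‖ ^ 2 ≤ ε := by
        rw [div_mul_eq_mul_div, div_le_iff₀ (by positivity)]; nlinarith
      rcases key (c + ε / (‖q ξ‖ ^ 2 + 1)) with h | h
      · have := h ξ₀
        rw [← hv] at this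
        nlinarith
      · have := h ξ
        nlinarith
    · refine le_of_forall_pos_le_add fun ε hε => ?_
      have hd : 0 < ε / (‖q ξ‖ ^ 2 + 1) := by positivity
      have hd' : ε / (‖q ξ‖ ^ 2 + 1) * ‖q ξ‖ ^ 2 ≤ ε := by
        rw [div_mul_eq_mul_div, div_le_iff₀ (by positivity)]; nlinarith
      rcases key (c - ε / (‖q ξ‖ ^ 2 + 1)) with h | h
      · have := h ξ
        nlinarith
      · have := h ξ₀
        rw [← hv] at this
        nlinarith
  refine ⟨c, ?_⟩
  have hn : ‖q * (x - (c : ℂ) • 1) * q‖ ≤ 0 := by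
    refine norm_le_of_abs_quadForm_le (by simp [hqp.1, hxs, mul_assoc]) le_rfl fun ξ => ?_
    have : quadForm (q * (x - (c : ℂ) • 1) * q) ξ = quadForm (x - (c : ℂ) • 1) (q ξ) := by
      simp only [quadForm, opMul_apply]
      rw [← hqp.inner_apply]
    rw [this, quadForm_sub_smul_one, hall]; simp
  have h0 := norm_le_zero_iff.1 hn
  rw [mul_sub, sub_mul, sub_eq_zero] at h0
  rw [h0]
  simp [hqp.2]

/-- A minimal projection compresses the algebra to the scalars. -/
theorem exists_eq_smul_of_minimal (C : VonNeumannAlgebra H) {q : H →L[ℂ] H}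
    (hq : IsMinimalProjectionIn (C : Set (H →L[ℂ] H)) q) {x : H →L[ℂ] H} (hx : x ∈ C) :
    ∃ c : ℂ, q * x * q = c • q := by
  have hxs : star x ∈ C := star_mem hx
  obtain ⟨c, hc⟩ := exists_eq_smul_of_minimal_of_star_eq C hq (add_mem hx hxs)
    (by simp [add_comm])
  obtain ⟨d, hd⟩ := exists_eq_smul_of_minimal_of_star_eq C hq
    (C.smul_mem' Complex.I (sub_mem hx hxs)) (by simp [smul_sub, neg_add_eq_sub])
  refine ⟨(c - Complex.I * d) / 2, ?_⟩
  have h1 : x = (1 / 2 : ℂ) • (x + star x) - (Complex.I / 2) • (Complex.I • (x - star x)) := by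
    have : (Complex.I / 2) * Complex.I = - (1 / 2) := by
      rw [div_mul_eq_mul_div, Complex.I_mul_I]; ring
    rw [smul_smul, this]
    module
  rw [h1, mul_sub, sub_mul, mul_smul_comm, smul_mul_assoc, hc, mul_smul_comm, smul_mul_assoc, hd,
    smul_smul, smul_smul, ← sub_smul]
  congr 1
  ring

/-- In a factor any two nonzero projections are connected by an element of the factor. -/
theorem IsFactor.exists_mul_ne_zero {N : VonNeumannAlgebra H} (hN : IsFactor N)
    {r r' : H →L[ℂ] H} (hr : r ∈ N) (hr0 : r ≠ 0) (hr'0 : r' ≠ 0) :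
    ∃ z ∈ N, r' * z * r ≠ 0 := by
  by_contra! hz
  set K : Submodule ℂ H := Submodule.span ℂ {v | ∃ z ∈ N, ∃ ξ, v = z (r ξ)} with hK
  have hinv : ∀ y : H →L[ℂ] H, (∀ z ∈ N, ∀ ξ, ∃ z' ∈ N, ∃ ξ', y (z (r ξ)) = z' (r ξ')) →
      ∀ v ∈ K, y v ∈ K := by
    intro y hy v hv
    induction hv using Submodule.span_induction with
    | mem v hv =>
      obtain ⟨z, hz, ξ, rfl⟩ := hv
      exact Submodule.subset_span (hy z hz ξ)
    | zero => simp
    | add a b _ _ ha hb => rw [map_add]; exact add_mem ha hb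
    | smul a b _ hb => rw [map_smul]; exact K.smul_mem a hb
  set e := K.topologicalClosure.starProjection with he
  have heN : e ∈ N := by
    refine N.starProjection_closure_mem K fun y hy => hinv y fun z hz ξ => ⟨z, hz, y ξ, ?_⟩
    have h1 : y (z (r ξ)) = z (y (r ξ)) :=
      (DFunLike.congr_fun (N.commute_of_mem hz hy) (r ξ)).symm
    have h2 : y (r ξ) = r (y ξ) := (DFunLike.congr_fun (N.commute_of_mem hr hy) ξ).symm
    rw [h1, h2]
  have heN' : e ∈ N.commutant := by
    refine N.commutant.starProjection_closure_mem K fun y hy =>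
      hinv y fun z hz ξ => ⟨y * z, mul_mem ?_ hz, ξ, rfl⟩
    rwa [N.commutant_commutant] at hy
  obtain ⟨c, hc⟩ := hN e heN fun y hy => (N.commute_of_mem hy heN').symm
  have hrK : ∀ z ∈ N, ∀ ξ, e (z (r ξ)) = z (r ξ) := fun z hz ξ =>
    Submodule.starProjection_eq_self_iff.2 (Submodule.le_topologicalClosure _
      (Submodule.subset_span ⟨z, hz, ξ, rfl⟩))
  have her : e * r = r := by
    ext ξ; simpa using hrK 1 (one_mem N) ξ
  have hc1 : c = 1 := by
    rw [hc, smul_mul_assoc, one_mul] at her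
    have : (c - 1) • r = 0 := by rw [sub_smul, her, one_smul, sub_self]
    rcases smul_eq_zero.1 this with h | h
    · exact sub_eq_zero.1 h
    · exact absurd h hr0
  have hr'e : r' * e = 0 := by
    rw [mul_starProjection_closure_congr (b := 0) he, zero_mul]
    intro v hv
    induction hv using Submodule.span_induction with
    | mem v hv =>
      obtain ⟨z, hz', ξ, rfl⟩ := hv
      exact DFunLike.congr_fun (hz z hz') ξ
    | zero => simp
    | add a b _ _ ha hb => rw [map_add, ha, hb]; simp
    | smul a b _ hb => rw [map_smul, hb]; simp
  rw [hc, hc1, one_smul, mul_one] at hr'e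
  exact hr'0 hr'e

/-! ### Good filters of projections -/

/-- The nonzero projections of a von Neumann algebra. -/
def nonzeroProj (N : VonNeumannAlgebra H) : Set (H →L[ℂ] H) :=
  {r | r ∈ N ∧ IsProjection r ∧ r ≠ 0}

/-- The nonzero projections of `N` that are almost below `q`. -/
def nearBelow (N : VonNeumannAlgebra H) (q : H →L[ℂ] H) (ε : ℝ) : Set (H →L[ℂ] H) :=
  {r | r ∈ nonzeroProj N ∧ ‖(1 - q) * r‖ < ε}

theorem self_mem_nearBelow {N : VonNeumannAlgebra H} {q : H →L[ℂ] H} (hq : q ∈ nonzeroProj N)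
    {ε : ℝ} (hε : 0 < ε) : q ∈ nearBelow N q ε := by
  refine ⟨hq, ?_⟩
  rw [sub_mul, hq.2.1.2]
  simpa using hε

theorem nearBelow_mono {N : VonNeumannAlgebra H} {q : H →L[ℂ] H} {ε ε' : ℝ} (h : ε ≤ ε') :
    nearBelow N q ε ⊆ nearBelow N q ε' := fun _ hr => ⟨hr.1, hr.2.trans_le h⟩

theorem norm_apply_le_of_mem_nearBelow {N : VonNeumannAlgebra H} {q r : H →L[ℂ] H} {ε : ℝ}
    (hr : r ∈ nearBelow N q ε) {ξ : H} (hξ : r ξ = ξ) : ‖(1 - q) ξ‖ ≤ ε * ‖ξ‖ := by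
  have h := ((1 - q) * r).le_of_opNorm_le hr.2.le ξ
  rwa [opMul_apply, hξ] at h

/-- If `r` is `ε`-below `q` and `q` is `ε'`-below `p`, then `r` is `(ε + ε')`-below `p`. -/
theorem nearBelow_trans {N : VonNeumannAlgebra H} {p q r : H →L[ℂ] H} {ε ε' : ℝ}
    (hp : IsProjection p) (hqp : q ∈ nearBelow N p ε') (hr : r ∈ nearBelow N q ε) :
    r ∈ nearBelow N p (ε + ε') := by
  refine ⟨hr.1, ?_⟩
  have h : (1 - p) * r = (1 - p) * ((1 - q) * r) + ((1 - p) * q) * r := by noncomm_ring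
  rw [h]
  have h1 : ‖(1 - p) * ((1 - q) * r)‖ ≤ ‖(1 - q) * r‖ :=
    (norm_mul_le _ _).trans (mul_le_of_le_one_left (norm_nonneg _) hp.one_sub.norm_le_one)
  have h2 : ‖((1 - p) * q) * r‖ ≤ ‖(1 - p) * q‖ :=
    (norm_mul_le _ _).trans (mul_le_of_le_one_right (norm_nonneg _) hr.1.2.1.norm_le_one)
  linarith [norm_add_le ((1 - p) * ((1 - q) * r)) (((1 - p) * q) * r), hr.2, hqp.2]

/-- If `e ≤ q`, being almost below `e` implies being almost below `q`. -/
theorem nearBelow_subset_of_le {N : VonNeumannAlgebra H} {e q : H →L[ℂ] H} {ε : ℝ}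
    (hq : IsProjection q) (h : q * e = e) : nearBelow N e ε ⊆ nearBelow N q ε := by
  intro r hr
  refine ⟨hr.1, lt_of_le_of_lt ?_ hr.2⟩
  have h1 : (1 - q) * r = (1 - q) * ((1 - e) * r) := by
    have : (1 - q) * e = 0 := by rw [sub_mul, one_mul, h, sub_self]
    rw [← mul_assoc, mul_sub, this, mul_one, sub_zero]
  rw [h1]
  exact (norm_mul_le _ _).trans
    (mul_le_of_le_one_left (norm_nonneg _) hq.one_sub.norm_le_one)

/-- A filter of projections of `N` which uniformly admits refinements. -/
structure IsGood (N : VonNeumannAlgebra H) (F : Filter (H →L[ℂ] H)) : Prop where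
  proj_mem : nonzeroProj N ∈ F
  exists_near : ∀ A ∈ F, ∃ τ > 0, ∀ τ' > 0, ∃ q ∈ nonzeroProj N,
    nearBelow N q τ ⊆ A ∧ nearBelow N q τ' ∈ F

namespace IsGood

variable {N : VonNeumannAlgebra H} {F : Filter (H →L[ℂ] H)}

theorem neBot (hF : IsGood N F) : F.NeBot := by
  refine ⟨fun h => ?_⟩
  obtain ⟨τ, hτ, hq⟩ := hF.exists_near ∅ (by simp [h])
  obtain ⟨q, hq, hqA, -⟩ := hq 1 one_pos
  exact hqA (self_mem_nearBelow hq hτ)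

theorem exists_near_mem (hF : IsGood N F) {A : Set (H →L[ℂ] H)} (hA : A ∈ F) :
    ∃ τ > 0, ∀ τ' > 0, ∀ A' ∈ F, ∃ q ∈ nonzeroProj N, q ∈ A' ∧
      nearBelow N q τ ⊆ A ∧ nearBelow N q τ' ∈ F := by
  obtain ⟨τ, hτ, h⟩ := hF.exists_near A hA
  obtain ⟨q₁, hq₁, hq₁A, hq₁F⟩ := h (τ / 2) (by positivity)
  refine ⟨τ / 2, by positivity, fun τ' hτ' A' hA' => ?_⟩
  obtain ⟨σ, hσ, h'⟩ := hF.exists_near _ (inter_mem hq₁F hA')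
  obtain ⟨q, hq, hqA, hqF⟩ := h' τ' hτ'
  have hmem := hqA (self_mem_nearBelow hq hσ)
  refine ⟨q, hq, hmem.2, fun r hr => hq₁A ?_, hqF⟩
  have := nearBelow_trans hq₁.2.1 hmem.1 hr
  rwa [add_halves] at this

/-- A directed infimum of good filters is good. -/
theorem iInf {ι : Type*} [Nonempty ι] {G : ι → Filter (H →L[ℂ] H)}
    (hdir : Directed (· ≥ ·) G) (hG : ∀ i, IsGood N (G i)) : IsGood N (⨅ i, G i) := by
  refine ⟨?_, fun A hA => ?_⟩
  · exact (mem_iInf_of_directed hdir _).2 ⟨Classical.arbitrary ι, (hG _).proj_mem⟩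
  · obtain ⟨i, hi⟩ := (mem_iInf_of_directed hdir _).1 hA
    obtain ⟨τ, hτ, h⟩ := (hG i).exists_near A hi
    refine ⟨τ, hτ, fun τ' hτ' => ?_⟩
    obtain ⟨q, hq, hqA, hqF⟩ := h τ' hτ'
    exact ⟨q, hq, hqA, (mem_iInf_of_directed hdir _).2 ⟨i, hqF⟩⟩

end IsGood

/-- The compressions of `x` by the projections of `F` converge to the scalar `c`. -/
def Decides (F : Filter (H →L[ℂ] H)) (x : H →L[ℂ] H) (c : ℂ) : Prop :=
  Tendsto (fun r : H →L[ℂ] H => ‖r * (x - c • 1) * r‖) F (𝓝 0)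

theorem Decides.mono {F G : Filter (H →L[ℂ] H)} {x : H →L[ℂ] H} {c : ℂ} (h : Decides F x c)
    (hGF : G ≤ F) : Decides G x c := Tendsto.mono_left h hGF

theorem quadForm_compress {r : H →L[ℂ] H} (hr : IsProjection r) (x : H →L[ℂ] H) (ξ : H) :
    quadForm (r * x * r) ξ = quadForm x (r ξ) := by
  simp only [quadForm, opMul_apply]
  rw [← hr.inner_apply]

/-- The set of `r` on whose range `x` is bounded below by `-δ`. -/
def lowerSet (x : H →L[ℂ] H) (δ : ℝ) : Set (H →L[ℂ] H) :=
  {r | ∀ ξ, -δ * ‖r ξ‖ ^ 2 ≤ quadForm x (r ξ)}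

theorem lowerSet_mono (x : H →L[ℂ] H) {δ δ' : ℝ} (h : δ ≤ δ') :
    lowerSet x δ ⊆ lowerSet x δ' := fun r hr ξ => by
  have := hr ξ
  nlinarith [sq_nonneg ‖r ξ‖]

/-- The refinement of `F` by all the sets `lowerSet x δ`. -/
def lowerFilter (F : Filter (H →L[ℂ] H)) (x : H →L[ℂ] H) : Filter (H →L[ℂ] H) :=
  F ⊓ ⨅ n : ℕ, 𝓟 (lowerSet x (1 / (n + 1)))

theorem antitone_lowerSet (x : H →L[ℂ] H) :
    Antitone fun n : ℕ => lowerSet x (1 / ((n : ℝ) + 1)) := fun _ _ h =>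
  lowerSet_mono x (one_div_le_one_div_of_le (by positivity) (by exact_mod_cast Nat.succ_le_succ h))

theorem mem_lowerFilter {F : Filter (H →L[ℂ] H)} {x : H →L[ℂ] H} {B : Set (H →L[ℂ] H)} :
    B ∈ lowerFilter F x ↔ ∃ A ∈ F, ∃ δ > 0, A ∩ lowerSet x δ ⊆ B := by
  have hdir : Directed (· ≥ ·) fun n : ℕ => 𝓟 (lowerSet x (1 / ((n : ℝ) + 1))) :=
    (show Antitone fun n : ℕ => 𝓟 (lowerSet x (1 / ((n : ℝ) + 1))) from
      fun _ _ h => principal_mono.2 (antitone_lowerSet x h)).directed_ge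
  rw [lowerFilter, mem_inf_iff_superset]
  constructor
  · rintro ⟨A, hA, L, hL, h⟩
    obtain ⟨n, hn⟩ := (mem_iInf_of_directed hdir _).1 hL
    exact ⟨A, hA, 1 / ((n : ℝ) + 1), by positivity,
      (Set.inter_subset_inter_right A (mem_principal.1 hn)).trans h⟩
  · rintro ⟨A, hA, δ, hδ, h⟩
    obtain ⟨n, hn⟩ := exists_nat_one_div_lt hδ
    refine ⟨A, hA, lowerSet x (1 / ((n : ℝ) + 1)), ?_, fun r hr => h ⟨hr.1, ?_⟩⟩
    · exact (mem_iInf_of_directed hdir _).2 ⟨n, mem_principal_self _⟩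
    · exact lowerSet_mono x hn.le hr.2

/-- The estimate behind the refinement of a good filter: a vector almost in the range of `q` on
which `x` is almost nonnegative is almost in the range of the spectral projection `e` of `q x q`. -/
theorem norm_one_sub_apply_sq_le {q e x : H →L[ℂ] H} {δ t : ℝ} (hq : IsProjection q)
    (he : IsProjection e) (hqe : q * e = e) (hx : star x = x) (hδ : 0 < δ) (ht : 0 ≤ t)
    (hup : ∀ ξ, quadForm x (q ξ) ≤ t * ‖q ξ‖ ^ 2)
    (hlow : ∀ ξ, quadForm x ((q - e) ξ) ≤ -δ * ‖(q - e) ξ‖ ^ 2)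
    (hcross : ∀ ξ η, ⟪e ξ, x ((q - e) η)⟫_ℂ = 0) {η : H} (h1 : ‖(1 - q) η‖ ≤ t * ‖η‖)
    (h2 : -t * ‖η‖ ^ 2 ≤ quadForm x η) :
    ‖(1 - e) η‖ ^ 2 ≤ ((2 + 2 * ‖x‖) * t / δ + t ^ 2) * ‖η‖ ^ 2 := by
  have hsplit : quadForm x (q η) = quadForm x (e η) + quadForm x ((q - e) η) := by
    have h : q η = e η + (q - e) η := by simp
    have hc' : ⟪(q - e) η, x (e η)⟫_ℂ = 0 := by
      rw [← inner_star_eq hx, ← inner_conj_symm, hcross, map_zero]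
    rw [h]
    simp only [quadForm, map_add, inner_add_left, inner_add_right, hcross, hc', Complex.add_re,
      add_zero, zero_add]
  have hqe' : q (e η) = e η := DFunLike.congr_fun hqe η
  have ha : quadForm x (e η) ≤ t * ‖η‖ ^ 2 := by
    have := hup (e η)
    rw [hqe'] at this
    have h3 := he.norm_apply_le η
    have : ‖e η‖ ^ 2 ≤ ‖η‖ ^ 2 := by gcongr
    nlinarith
  have hpert := abs_le.1 (abs_quadForm_sub_le x (a := q η) (η := η) (t := t) (hq.norm_apply_le η)
    (by simpa using h1))
  have hb := hlow η
  have hbd : ‖(q - e) η‖ ^ 2 ≤ (2 + 2 * ‖x‖) * t / δ * ‖η‖ ^ 2 := by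
    rw [div_mul_eq_mul_div, le_div_iff₀ hδ]
    nlinarith [hpert.2]
  have hpy := hq.norm_sq_add ((1 - e) η)
  have e1 : q ((1 - e) η) = (q - e) η := by simp [hqe']
  have e2 : (1 - q) ((1 - e) η) = (1 - q) η := by simp [hqe']
  rw [e1, e2] at hpy
  have : ‖(1 - q) η‖ ^ 2 ≤ (t * ‖η‖) ^ 2 := by gcongr
  nlinarith

theorem isGood_lowerFilter {N : VonNeumannAlgebra H} {F : Filter (H →L[ℂ] H)} (hF : IsGood N F)
    {x : H →L[ℂ] H} (hx : star x = x) (hxN : x ∈ N)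
    (hup : ∀ t > 0, ∀ᶠ r in F, ∀ ξ, quadForm x (r ξ) ≤ t * ‖r ξ‖ ^ 2)
    (hfr : ∀ t > 0, ∃ᶠ r in F, ∃ η, r η = η ∧ η ≠ 0 ∧ -t * ‖η‖ ^ 2 ≤ quadForm x η) :
    IsGood N (lowerFilter F x) := by
  have hle : lowerFilter F x ≤ F := inf_le_left
  refine ⟨hle hF.proj_mem, fun B hB => ?_⟩
  obtain ⟨A, hA, δ, hδ, hAB⟩ := mem_lowerFilter.1 hB
  obtain ⟨τ, hτ, hnear⟩ := hF.exists_near_mem hA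
  set ε₁ : ℝ := min τ (δ / (4 * ‖x‖ + 4)) with hε₁
  have hε₁τ : ε₁ ≤ τ := min_le_left _ _
  have hε₁δ : ε₁ * (4 * ‖x‖ + 4) ≤ δ := by
    rw [← le_div_iff₀ (by positivity)]; exact min_le_right _ _
  have hε₁pos : 0 < ε₁ := by positivity
  refine ⟨ε₁, hε₁pos, fun ε₀ hε₀ => ?_⟩
  set ε₂ : ℝ := min ε₀ 1 with hε₂
  have hε₂pos : 0 < ε₂ := by positivity
  have hε₂1 : ε₂ ≤ 1 := min_le_right _ _
  have hδ₁ : 0 < δ / 2 := by positivity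
  set D : ℝ := (2 + 2 * ‖x‖) / (δ / 2) + 1 with hD
  have hDpos : 0 < D := by positivity
  set t : ℝ := min 1 (ε₂ ^ 2 / 4 / D) with ht
  have htpos : 0 < t := by positivity
  have ht1 : t ≤ 1 := min_le_left _ _
  have htD : t * D ≤ ε₂ ^ 2 / 4 := by
    rw [← le_div_iff₀ hDpos]; exact min_le_right _ _
  have hbound : (2 + 2 * ‖x‖) * t / (δ / 2) + t ^ 2 ≤ (ε₂ / 2) ^ 2 := by
    have : (2 + 2 * ‖x‖) * t / (δ / 2) = t * ((2 + 2 * ‖x‖) / (δ / 2)) := by ring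
    nlinarith
  obtain ⟨q, hq, hqup, hqA, hqF⟩ := hnear t htpos _ (hup t htpos)
  obtain ⟨e, heN, hep, hqe, heq, hlow, hhigh, hcross⟩ :=
    exists_spectral_projection N hq.2.1 hq.1 hx hxN (-(δ / 2))
  have est : ∀ η, ‖(1 - q) η‖ ≤ t * ‖η‖ → -t * ‖η‖ ^ 2 ≤ quadForm x η →
      ‖(1 - e) η‖ ≤ ε₂ / 2 * ‖η‖ := by
    intro η h1 h2
    have := norm_one_sub_apply_sq_le hq.2.1 hep hqe hx hδ₁ htpos.le hqup hhigh hcross h1 h2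
    refine le_of_sq_le_sq ?_ (by positivity)
    rw [mul_pow]
    exact this.trans (by gcongr)
  have he0 : e ≠ 0 := by
    rintro rfl
    obtain ⟨r, ⟨η, hη, hη0, h2⟩, hr⟩ := ((hfr t htpos).and_eventually hqF).exists
    have := est η (norm_apply_le_of_mem_nearBelow hr hη) h2
    rw [sub_zero, one_apply_eq_self] at this
    have hpos : 0 < ‖η‖ := norm_pos_iff.2 hη0
    nlinarith
  refine ⟨e, ⟨heN, hep, he0⟩, fun r hr => hAB ⟨hqA ?_, fun ξ => ?_⟩, ?_⟩
  · exact nearBelow_mono hε₁τ (nearBelow_subset_of_le hq.2.1 hqe hr)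
  · have hrr : r (r ξ) = r ξ := hr.1.2.1.apply_apply ξ
    have h1 := norm_apply_le_of_mem_nearBelow hr hrr
    have h2 := abs_le.1 (abs_quadForm_sub_le x (a := e (r ξ)) (η := r ξ) (t := ε₁)
      (hep.norm_apply_le _) (by simpa using h1))
    have h3 := hlow (r ξ)
    have h4 : ‖e (r ξ)‖ ^ 2 ≤ ‖r ξ‖ ^ 2 := by gcongr; exact hep.norm_apply_le _
    have h5 : 2 * ‖x‖ * ε₁ ≤ δ / 2 := by nlinarith
    have h6 : 2 * ‖x‖ * ε₁ * ‖r ξ‖ ^ 2 ≤ δ / 2 * ‖r ξ‖ ^ 2 := by gcongr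
    nlinarith [h2.1]
  · refine mem_lowerFilter.2 ⟨_, hqF, t, htpos, fun r hr => ⟨hr.1.1, ?_⟩⟩
    have hrp := hr.1.1.2.1
    refine lt_of_le_of_lt (b := ε₂ / 2) ?_ (by linarith [min_le_left ε₀ 1])
    refine ContinuousLinearMap.opNorm_le_bound _ (by positivity) fun ξ => ?_
    have := est (r ξ) (norm_apply_le_of_mem_nearBelow hr.1 (hrp.apply_apply ξ)) (hr.2 ξ)
    rw [opMul_apply]
    exact this.trans (by gcongr; exact hrp.norm_apply_le ξ)

theorem decides_lowerFilter {N : VonNeumannAlgebra H} {F : Filter (H →L[ℂ] H)} (hF : IsGood N F)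
    {x : H →L[ℂ] H} (hx : star x = x)
    (hup : ∀ t > 0, ∀ᶠ r in F, ∀ ξ, quadForm x (r ξ) ≤ t * ‖r ξ‖ ^ 2) :
    Decides (lowerFilter F x) x 0 := by
  refine Metric.tendsto_nhds.2 fun ε hε => ?_
  refine mem_lowerFilter.2 ⟨_, inter_mem hF.proj_mem (hup (ε / 2) (by positivity)), ε / 2,
    by positivity, ?_⟩
  rintro r ⟨⟨hr, hrup⟩, hrlow⟩
  simp only [Set.mem_ofPred_eq, zero_smul, sub_zero, dist_zero_right, norm_norm]
  refine lt_of_le_of_lt (b := ε / 2) ?_ (by linarith)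
  refine norm_le_of_abs_quadForm_le (by simp [hr.2.1.1, hx, mul_assoc]) (by positivity) fun ξ => ?_
  rw [quadForm_compress hr.2.1, abs_le]
  have h1 : ‖r ξ‖ ^ 2 ≤ ‖ξ‖ ^ 2 := by gcongr; exact hr.2.1.norm_apply_le _
  constructor
  · nlinarith [hrlow ξ]
  · nlinarith [show quadForm x (r ξ) ≤ ε / 2 * ‖r ξ‖ ^ 2 from hrup ξ]

/-- A good filter can be refined to a good filter deciding a given self-adjoint element, with a
value at least as large as any value frequently attained on vectors. -/
theorem IsGood.exists_decides {N : VonNeumannAlgebra H} {F : Filter (H →L[ℂ] H)} (hF : IsGood N F)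
    {x : H →L[ℂ] H} (hx : star x = x) (hxN : x ∈ N) :
    ∃ G ≤ F, IsGood N G ∧ (F.IsCountablyGenerated → G.IsCountablyGenerated) ∧
      ∃ l : ℝ, Decides G x (l : ℂ) ∧
        ∀ c : ℝ, (∃ᶠ r in F, ∃ η, r η = η ∧ η ≠ 0 ∧ c * ‖η‖ ^ 2 ≤ quadForm x η) → c ≤ l := by
  have hne := hF.neBot
  set S : Set ℝ := {c | ∀ᶠ r in F, ∀ ξ, quadForm x (r ξ) ≤ c * ‖r ξ‖ ^ 2} with hS
  have hlb : ∀ c : ℝ, (∃ᶠ r in F, ∃ η, r η = η ∧ η ≠ 0 ∧ c * ‖η‖ ^ 2 ≤ quadForm x η) →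
      ∀ c' ∈ S, c ≤ c' := by
    intro c hc c' hc'
    obtain ⟨r, ⟨η, hη, hη0, h1⟩, h2⟩ := (hc.and_eventually hc').exists
    have h3 := h2 η
    rw [hη] at h3
    have hpos : 0 < ‖η‖ ^ 2 := by have := norm_pos_iff.2 hη0; positivity
    exact le_of_mul_le_mul_right (h1.trans h3) hpos
  have hSne : S.Nonempty := ⟨‖x‖, Eventually.of_forall fun r ξ =>
    (le_abs_self _).trans (abs_quadForm_le x _)⟩
  have hSbdd : BddBelow S := by
    refine ⟨-‖x‖, fun c hc => hlb (-‖x‖) ?_ c hc⟩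
    refine Eventually.frequently ?_
    filter_upwards [hF.proj_mem] with r hr
    obtain ⟨ξ, hξ⟩ := IsProjection.exists_apply_ne_zero hr.2.2
    refine ⟨r ξ, hr.2.1.apply_apply ξ, hξ, ?_⟩
    have := (abs_le.1 (abs_quadForm_le x (r ξ))).1
    linarith
  set l : ℝ := sInf S with hl
  set y : H →L[ℂ] H := x - (l : ℂ) • 1 with hy
  have hys : star y = y := by simp [hy, hx]
  have hyN : y ∈ N := sub_mem hxN (N.smul_mem' _ (one_mem N))
  have hup : ∀ t > 0, ∀ᶠ r in F, ∀ ξ, quadForm y (r ξ) ≤ t * ‖r ξ‖ ^ 2 := by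
    intro t ht
    obtain ⟨c, hcS, hc⟩ := exists_lt_of_csInf_lt hSne (show sInf S < l + t by linarith)
    filter_upwards [show ∀ᶠ r in F, ∀ ξ, quadForm x (r ξ) ≤ c * ‖r ξ‖ ^ 2 from hcS] with r hr ξ
    have := hr ξ
    rw [hy, quadForm_sub_smul_one]
    nlinarith [sq_nonneg ‖r ξ‖]
  have hfr : ∀ t > 0, ∃ᶠ r in F, ∃ η, r η = η ∧ η ≠ 0 ∧ -t * ‖η‖ ^ 2 ≤ quadForm y η := by
    intro t ht
    have hnot : l - t ∉ S := fun h => by linarith [csInf_le hSbdd h]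
    have hfreq : ∃ᶠ r in F, ¬ ∀ ξ, quadForm x (r ξ) ≤ (l - t) * ‖r ξ‖ ^ 2 := by
      rwa [← not_eventually] at *
    refine (hfreq.and_eventually hF.proj_mem).mono ?_
    rintro r ⟨h, hr⟩
    push Not at h
    obtain ⟨ξ, hξ⟩ := h
    refine ⟨r ξ, hr.2.1.apply_apply ξ, ?_, ?_⟩
    · intro h0
      rw [h0] at hξ
      simp [quadForm] at hξ
    · rw [hy, quadForm_sub_smul_one]
      linarith
  refine ⟨lowerFilter F y, inf_le_left, isGood_lowerFilter hF hys hyN hup hfr, ?_, l, ?_, ?_⟩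
  · intro hcg
    unfold lowerFilter
    infer_instance
  · have := decides_lowerFilter hF hys hup
    simpa only [Decides, zero_smul, sub_zero] using this
  · exact fun c hc => le_csInf hSne (hlb c hc)

/-! ### Block-diagonal sums along an increasing sequence of projections -/

/-- An increasing sequence of projections of `N` converging strongly to the identity. -/
structure IsExhaustion (N : VonNeumannAlgebra H) (P : ℕ → H →L[ℂ] H) : Prop where
  mem : ∀ n, P n ∈ N
  proj : ∀ n, IsProjection (P n)
  mul_eq : ∀ n m, n ≤ m → P n * P m = P n
  tendsto : ∀ ξ, Tendsto (fun n => P n ξ) atTop (𝓝 ξ)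

namespace IsExhaustion

variable {N : VonNeumannAlgebra H} {P : ℕ → H →L[ℂ] H}

theorem mul_eq' (hP : IsExhaustion N P) {n m : ℕ} (h : n ≤ m) : P m * P n = P n :=
  by simpa [(hP.proj n).1, (hP.proj m).1] using congrArg star (hP.mul_eq n m h)

theorem comp (hP : IsExhaustion N P) {k : ℕ → ℕ} (hk : StrictMono k) :
    IsExhaustion N fun i => P (k i) :=
  ⟨fun _ => hP.mem _, fun _ => hP.proj _, fun _ _ h => hP.mul_eq _ _ (hk.monotone h),
    fun ξ => (hP.tendsto ξ).comp hk.tendsto_atTop⟩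

theorem isProjection_sub (hP : IsExhaustion N P) {n m : ℕ} (h : n ≤ m) :
    IsProjection (P m - P n) :=
  (hP.proj m).sub (hP.proj n) (hP.mul_eq n m h) (hP.mul_eq' h)

/-- Consecutive differences are orthogonal. -/
theorem sub_mul_sub (hP : IsExhaustion N P) {n m l : ℕ} (h : n ≤ m) (h' : m ≤ l) :
    (P m - P n) * (P l - P m) = 0 := by
  rw [sub_mul, mul_sub, mul_sub, hP.mul_eq _ _ h', (hP.proj m).2, hP.mul_eq _ _ (h.trans h'),
    hP.mul_eq _ _ h]
  simp

theorem eq_zero_of_mul_eq_zero (hP : IsExhaustion N P) {X : H →L[ℂ] H} (h0 : X * P 0 = 0)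
    (h : ∀ i, X * (P (i + 1) - P i) = 0) : X = 0 := by
  have hall : ∀ i, X * P i = 0 := by
    intro i
    induction i with
    | zero => exact h0
    | succ i ih => have := h i; rwa [mul_sub, ih, sub_zero] at this
  ext ξ
  have h1 : Tendsto (fun n => X (P n ξ)) atTop (𝓝 (X ξ)) :=
    (X.continuous.tendsto ξ).comp (hP.tendsto ξ)
  have h2 : (fun n => X (P n ξ)) = fun _ => 0 := funext fun n => DFunLike.congr_fun (hall n) ξ
  rw [h2] at h1
  exact tendsto_nhds_unique h1 tendsto_const_nhds

end IsExhaustion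

theorem norm_add_le_one_of_block {p s y : H →L[ℂ] H} (hp : IsProjection p)
    (hs : p * s = s) (hs' : s * p = s) (hy : p * y = 0) (hy' : y * p = 0) (hs1 : ‖s‖ ≤ 1)
    (hy1 : ‖y‖ ≤ 1) : ‖s + y‖ ≤ 1 := by
  refine ContinuousLinearMap.opNorm_le_bound _ zero_le_one fun ξ => ?_
  rw [one_mul]
  refine le_of_sq_le_sq ?_ (norm_nonneg _)
  have e1 : p ((s + y) ξ) = s (p ξ) := by
    have h1 : p (s ξ) = s ξ := DFunLike.congr_fun hs ξ
    have h2 : p (y ξ) = 0 := DFunLike.congr_fun hy ξ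
    have h3 : s (p ξ) = s ξ := DFunLike.congr_fun hs' ξ
    rw [add_apply, map_add, h1, h2, h3, add_zero]
  have e2 : (1 - p) ((s + y) ξ) = y ((1 - p) ξ) := by
    have h1 : p (s ξ) = s ξ := DFunLike.congr_fun hs ξ
    have h2 : p (y ξ) = 0 := DFunLike.congr_fun hy ξ
    have h3 : y (p ξ) = 0 := DFunLike.congr_fun hy' ξ
    simp [h1, h2, h3]
  rw [← hp.norm_sq_add ((s + y) ξ), ← hp.norm_sq_add ξ, e1, e2]
  have b1 : ‖s (p ξ)‖ ≤ ‖p ξ‖ := by simpa using s.le_of_opNorm_le hs1 (p ξ)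
  have b2 : ‖y ((1 - p) ξ)‖ ≤ ‖(1 - p) ξ‖ := by simpa using y.le_of_opNorm_le hy1 ((1 - p) ξ)
  gcongr

/-- The strong sum of a sequence of contractions supported on the consecutive blocks of an
exhaustion. -/
theorem IsExhaustion.exists_blockSum {N : VonNeumannAlgebra H} {R : ℕ → H →L[ℂ] H}
    (hR : IsExhaustion N R) {a : ℕ → H →L[ℂ] H} (ha1 : ∀ i, ‖a i‖ ≤ 1)
    (ha : ∀ i, (R (i + 1) - R i) * a i = a i) (ha' : ∀ i, a i * (R (i + 1) - R i) = a i) :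
    ∃ Y : H →L[ℂ] H, ‖Y‖ ≤ 1 ∧ (∀ C : VonNeumannAlgebra H, (∀ i, a i ∈ C) → Y ∈ C) ∧
      R 0 * Y = 0 ∧ Y * R 0 = 0 ∧
      (∀ i, (R (i + 1) - R i) * Y = a i) ∧ ∀ i, Y * (R (i + 1) - R i) = a i := by
  set S : ℕ → H →L[ℂ] H := fun k => ∑ i ∈ Finset.range k, a i with hS
  have hSs : ∀ k, S (k + 1) = S k + a k := fun k => Finset.sum_range_succ _ _
  have hRa : ∀ i k, k ≤ i → R k * a i = 0 := fun i k hk => by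
    rw [← ha i, ← mul_assoc, mul_sub, hR.mul_eq _ _ hk, hR.mul_eq _ _ (hk.trans i.le_succ),
      sub_self, zero_mul]
  have haR : ∀ i k, k ≤ i → a i * R k = 0 := fun i k hk => by
    rw [← ha' i, mul_assoc, sub_mul, hR.mul_eq' hk, hR.mul_eq' (hk.trans i.le_succ),
      sub_self, mul_zero]
  have hRa' : ∀ i k, i < k → R k * a i = a i := fun i k hk => by
    rw [← ha i, ← mul_assoc, mul_sub, hR.mul_eq' hk, hR.mul_eq' hk.le]
  have haR' : ∀ i k, i < k → a i * R k = a i := fun i k hk => by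
    rw [← ha' i, mul_assoc, sub_mul, hR.mul_eq _ _ hk, hR.mul_eq _ _ hk.le]
  have hRS : ∀ k, R k * S k = S k := fun k => by
    rw [hS]; simp only [Finset.mul_sum]
    exact Finset.sum_congr rfl fun i hi => hRa' i k (Finset.mem_range.1 hi)
  have hSR : ∀ k, S k * R k = S k := fun k => by
    rw [hS]; simp only [Finset.sum_mul]
    exact Finset.sum_congr rfl fun i hi => haR' i k (Finset.mem_range.1 hi)
  have hRSl : ∀ k d, R k * S (k + d) = S k := fun k d => by
    induction d with
    | zero => exact hRS k
    | succ d ih => rw [← add_assoc, hSs, mul_add, ih, hRa _ _ (Nat.le_add_right k d), add_zero]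
  have hSRl : ∀ k d, S (k + d) * R k = S k := fun k d => by
    induction d with
    | zero => exact hSR k
    | succ d ih => rw [← add_assoc, hSs, add_mul, ih, haR _ _ (Nat.le_add_right k d), add_zero]
  have hSn : ∀ k, ‖S k‖ ≤ 1 := fun k => by
    induction k with
    | zero => simp [hS]
    | succ k ih =>
      rw [hSs]
      exact norm_add_le_one_of_block (hR.proj k) (hRS k) (hSR k) (hRa k k le_rfl)
        (haR k k le_rfl) ih (ha1 k)
  have hcau : ∀ ξ, CauchySeq fun k => S k ξ := by
    intro ξ
    refine cauchySeq_of_le_tendsto_0' (fun k => 2 * ‖ξ - R k ξ‖) (fun k l hkl => ?_) ?_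
    · obtain ⟨d, rfl⟩ := Nat.exists_eq_add_of_le hkl
      have h1 : S k ξ - S (k + d) ξ = S k (ξ - R k ξ) - S (k + d) (ξ - R k ξ) := by
        have e1 : S k (R k ξ) = S k ξ := DFunLike.congr_fun (hSR k) ξ
        have e2 : S (k + d) (R k ξ) = S k ξ := DFunLike.congr_fun (hSRl k d) ξ
        rw [map_sub, map_sub, e1, e2]; abel
      rw [dist_eq_norm, h1]
      have b1 := (S k).le_of_opNorm_le (hSn k) (ξ - R k ξ)
      have b2 := (S (k + d)).le_of_opNorm_le (hSn (k + d)) (ξ - R k ξ)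
      linarith [norm_sub_le (S k (ξ - R k ξ)) (S (k + d) (ξ - R k ξ))]
    · have : Tendsto (fun k => 2 * ‖ξ - R k ξ‖) atTop (𝓝 (2 * ‖ξ - ξ‖)) :=
        ((tendsto_const_nhds.sub (hR.tendsto ξ)).norm).const_mul 2
      simpa using this
  choose y hy using fun ξ => cauchySeq_tendsto_of_complete (hcau ξ)
  set Y : H →L[ℂ] H := continuousLinearMapOfTendsto S (tendsto_pi_nhds.2 hy) with hY
  have hYlim : ∀ ξ, Tendsto (fun k => S k ξ) atTop (𝓝 (Y ξ)) := hy
  have hlimL : ∀ b z : H →L[ℂ] H, (∀ᶠ k in atTop, b * S k = z) → b * Y = z := by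
    intro b z h
    ext ξ
    have h1 : Tendsto (fun k => b (S k ξ)) atTop (𝓝 (b (Y ξ))) :=
      (b.continuous.tendsto _).comp (hYlim ξ)
    refine tendsto_nhds_unique h1 (tendsto_const_nhds.congr' ?_)
    filter_upwards [h] with k hk
    rw [← hk]; rfl
  have hlimR : ∀ b z : H →L[ℂ] H, (∀ᶠ k in atTop, S k * b = z) → Y * b = z := by
    intro b z h
    ext ξ
    refine tendsto_nhds_unique (hYlim (b ξ)) (tendsto_const_nhds.congr' ?_)
    filter_upwards [h] with k hk
    rw [← hk]; rfl
  have hRY : ∀ k, R k * Y = S k := fun k => hlimL _ _ <| by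
    filter_upwards [eventually_ge_atTop k] with l hl
    obtain ⟨d, rfl⟩ := Nat.exists_eq_add_of_le hl
    exact hRSl k d
  have hYR : ∀ k, Y * R k = S k := fun k => hlimR _ _ <| by
    filter_upwards [eventually_ge_atTop k] with l hl
    obtain ⟨d, rfl⟩ := Nat.exists_eq_add_of_le hl
    exact hSRl k d
  refine ⟨Y, ?_, ?_, ?_, ?_, fun i => ?_, fun i => ?_⟩
  · refine ContinuousLinearMap.opNorm_le_bound _ zero_le_one fun ξ => ?_
    exact le_of_tendsto (hYlim ξ).norm (Eventually.of_forall fun k =>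
      (S k).le_of_opNorm_le (hSn k) ξ)
  · intro C hC
    refine C.mem_of_commute fun w hw => ?_
    ext ξ
    have hSC : ∀ k, S k ∈ C := fun k => sum_mem fun i _ => hC i
    have h1 : Tendsto (fun k => w (S k ξ)) atTop (𝓝 (w (Y ξ))) :=
      (w.continuous.tendsto _).comp (hYlim ξ)
    refine tendsto_nhds_unique h1 ((hYlim (w ξ)).congr fun k => ?_)
    exact DFunLike.congr_fun (C.commute_of_mem (hSC k) hw) ξ
  · rw [hRY]; simp [hS]
  · rw [hYR]; simp [hS]
  · rw [sub_mul, hRY, hRY, hSs]; abel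
  · rw [mul_sub, hYR, hYR, hSs]; abel

/-- The off-diagonal block sum attached to contractions mapping the first half of each block to
the second half. -/
theorem IsExhaustion.exists_offDiagonal {N : VonNeumannAlgebra H} {P : ℕ → H →L[ℂ] H}
    (hP : IsExhaustion N P) {k m : ℕ → ℕ} (hk : StrictMono k) (hkm : ∀ i, k i ≤ m i)
    (hmk : ∀ i, m i ≤ k (i + 1)) {y : ℕ → H →L[ℂ] H} (hyN : ∀ i, y i ∈ N) (hy1 : ∀ i, ‖y i‖ ≤ 1)
    (hy : ∀ i, (P (k (i + 1)) - P (m i)) * y i = y i)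
    (hy' : ∀ i, y i * (P (m i) - P (k i)) = y i) :
    ∃ e Y : H →L[ℂ] H, IsProjection e ∧ (∀ C : VonNeumannAlgebra H, (∀ n, P n ∈ C) → e ∈ C) ∧
      Y ∈ N ∧ ‖Y‖ ≤ 1 ∧ e * Y = 0 ∧ Y * (1 - e) = 0 ∧
      (∀ i, (P (k (i + 1)) - P (k i)) * Y = y i) ∧ ∀ i, Y * (P (k (i + 1)) - P (k i)) = y i := by
  have hR := hP.comp hk
  set Q : ℕ → H →L[ℂ] H := fun i => P (k (i + 1)) - P (k i) with hQ
  set B : ℕ → H →L[ℂ] H := fun i => P (m i) - P (k i) with hB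
  set B' : ℕ → H →L[ℂ] H := fun i => P (k (i + 1)) - P (m i) with hB'
  have hkk : ∀ i, k i ≤ k (i + 1) := fun i => hk.monotone i.le_succ
  have hBp : ∀ i, IsProjection (B i) := fun i => hP.isProjection_sub (hkm i)
  have hB'p : ∀ i, IsProjection (B' i) := fun i => hP.isProjection_sub (hmk i)
  have hQp : ∀ i, IsProjection (Q i) := fun i => hP.isProjection_sub (hkk i)
  have hQsum : ∀ i, Q i = B i + B' i := fun i => by simp [hQ, hB, hB']
  have hBB' : ∀ i, B i * B' i = 0 := fun i => hP.sub_mul_sub (hkm i) (hmk i)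
  have hB'B : ∀ i, B' i * B i = 0 := fun i => by
    simpa [(hBp i).1, (hB'p i).1] using congrArg star (hBB' i)
  have hQB : ∀ i, Q i * B i = B i := fun i => by
    rw [hQsum, add_mul, (hBp i).2, hB'B, add_zero]
  have hBQ : ∀ i, B i * Q i = B i := fun i => by
    rw [hQsum, mul_add, (hBp i).2, hBB', add_zero]
  have hBy : ∀ i, B i * y i = 0 := fun i => by
    rw [← hy i]
    change B i * (B' i * y i) = 0
    rw [← mul_assoc, hBB', zero_mul]
  have hyB : ∀ i, y i * B i = y i := hy'
  have hB'y : ∀ i, B' i * y i = y i := hy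
  have hyB' : ∀ i, y i * B' i = 0 := fun i => by rw [← hyB i, mul_assoc, hBB', mul_zero]
  have hQy : ∀ i, Q i * y i = y i := fun i => by rw [hQsum, add_mul, hBy, hB'y, zero_add]
  have hyQ : ∀ i, y i * Q i = y i := fun i => by rw [hQsum, mul_add, hyB, hyB', add_zero]
  obtain ⟨Y, hY1, hYN, hRY, hYR, hQY, hYQ⟩ := hR.exists_blockSum hy1 hQy hyQ
  obtain ⟨e, -, heC, hRe, heR, hQe, heQ⟩ := hR.exists_blockSum (fun i => (hBp i).norm_le_one)
    hQB hBQ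
  have heQ' : ∀ i, e * Q i = B i := heQ
  have hQe' : ∀ i, Q i * e = B i := hQe
  have hYQ' : ∀ i, Y * Q i = y i := hYQ
  have hes : star e = e := by
    rw [← sub_eq_zero]
    refine hR.eq_zero_of_mul_eq_zero ?_ fun i => ?_
    · have h1 : star e * P (k 0) = star (P (k 0) * e) := by rw [star_mul, (hP.proj _).1]
      rw [sub_mul, heR, sub_zero, h1, hRe, star_zero]
    · change (star e - e) * Q i = 0
      have h1 : star e * Q i = star (Q i * e) := by rw [star_mul, (hQp _).1]
      rw [sub_mul, heQ', h1, hQe', (hBp i).1, sub_self]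
  have hee : e * e = e := by
    rw [← sub_eq_zero]
    refine hR.eq_zero_of_mul_eq_zero ?_ fun i => ?_
    · rw [sub_mul, mul_assoc, heR, mul_zero, sub_zero]
    · change (e * e - e) * Q i = 0
      rw [sub_mul, mul_assoc, heQ', ← hQB i, ← mul_assoc, heQ', (hBp i).2, hQB, sub_self]
  refine ⟨e, Y, ⟨hes, hee⟩, fun C hC => heC C fun i => sub_mem (hC _) (hC _),
    hYN N hyN, hY1, ?_, ?_, hQY, hYQ⟩
  · refine hR.eq_zero_of_mul_eq_zero ?_ fun i => ?_
    · rw [mul_assoc, hYR, mul_zero]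
    · change e * Y * Q i = 0
      rw [mul_assoc, hYQ', ← hQy i, ← mul_assoc, heQ', hBy]
  · refine hR.eq_zero_of_mul_eq_zero ?_ fun i => ?_
    · rw [mul_assoc, sub_mul, heR, one_mul, sub_zero, hYR]
    · change Y * (1 - e) * Q i = 0
      rw [mul_assoc, sub_mul, heQ', one_mul, mul_sub, hYQ', ← hQB i, ← mul_assoc, hYQ', hyB,
        sub_self]

/-! ### Settling an exhaustion -/

theorem exists_lt_norm_apply {T : H →L[ℂ] H} {c : ℝ} (hc : 0 ≤ c) (h : c < ‖T‖) :
    ∃ v, c * ‖v‖ < ‖T v‖ := by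
  by_contra! hv
  exact absurd (T.opNorm_le_bound hc hv) (not_le.2 h)

/-- Below a projection near which the filter lives there is a projection almost supported on a
block of the exhaustion. -/
theorem IsExhaustion.exists_block_projection {N : VonNeumannAlgebra H} {P : ℕ → H →L[ℂ] H}
    (hP : IsExhaustion N P) {F : Filter (H →L[ℂ] H)} (hF : IsGood N F)
    (hsmall : ∀ n, ∀ ε > 0, ∀ᶠ r in F, ‖P n * r‖ < ε) {q : H →L[ℂ] H} (hq : q ∈ nonzeroProj N)
    {δ : ℝ} (hδ : 0 < δ) (hδ1 : δ ≤ 1) (hqF : nearBelow N q (δ / 8) ∈ F) (n : ℕ) :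
    ∃ m, n < m ∧ ∃ r ∈ nonzeroProj N, q * r = r ∧
      ∀ ξ, r ξ = ξ → ‖(1 - (P m - P n)) ξ‖ ≤ δ * ‖ξ‖ := by
  have hne := hF.neBot
  obtain ⟨r₀, hr₀, hr₀P⟩ :=
    ((show ∀ᶠ r in F, r ∈ nearBelow N q (δ / 8) from hqF).and
      (hsmall n (δ / 8) (by positivity))).exists
  obtain ⟨v, hv⟩ := IsProjection.exists_apply_ne_zero hr₀.1.2.2
  set ξ := r₀ v with hξ
  have hrξ : r₀ ξ = ξ := hr₀.1.2.1.apply_apply v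
  have hpos : 0 < ‖ξ‖ := norm_pos_iff.2 hv
  have h1 : ‖(1 - q) ξ‖ ≤ δ / 8 * ‖ξ‖ := norm_apply_le_of_mem_nearBelow hr₀ hrξ
  have h2 : ‖P n ξ‖ ≤ δ / 8 * ‖ξ‖ := by
    have := (P n * r₀).le_of_opNorm_le hr₀P.le ξ
    rwa [opMul_apply, hrξ] at this
  obtain ⟨m, hm, hnm⟩ : ∃ m, ‖ξ - P m ξ‖ < δ / 8 * ‖ξ‖ ∧ n < m := by
    have h3 : Tendsto (fun m => ‖ξ - P m ξ‖) atTop (𝓝 0) := by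
      simpa using ((tendsto_const_nhds (x := ξ)).sub (hP.tendsto ξ)).norm
    exact ((h3.eventually (gt_mem_nhds (by positivity))).and (eventually_gt_atTop n)).exists
  set B := P m - P n with hB
  have hBp : IsProjection B := hP.isProjection_sub hnm.le
  have hBN : B ∈ N := sub_mem (hP.mem m) (hP.mem n)
  have hqfB : ∀ w, quadForm B w = ‖w‖ ^ 2 - ‖(1 - B) w‖ ^ 2 := fun w => by
    rw [hBp.quadForm_self]; linarith [hBp.norm_sq_add w]
  obtain ⟨e, heN, hep, hqe, -, hlow, hhigh, -⟩ :=
    exists_spectral_projection N hq.2.1 hq.1 hBp.1 hBN (1 - δ ^ 2)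
  refine ⟨m, hnm, e, ⟨heN, hep, ?_⟩, hqe, fun w hw => ?_⟩
  · rintro rfl
    have h4 := hhigh ξ
    rw [sub_zero, hqfB] at h4
    have h5 : ‖(1 - B) (q ξ)‖ ≤ 3 * δ / 8 * ‖ξ‖ := by
      have e1 : (1 - B) (q ξ) = (ξ - P m ξ) + P n ξ - (1 - B) ((1 - q) ξ) := by
        simp [hB]; abel
      rw [e1]
      have h6 := (hBp.one_sub.norm_apply_le ((1 - q) ξ)).trans h1
      calc _ ≤ ‖ξ - P m ξ‖ + ‖P n ξ‖ + ‖(1 - B) ((1 - q) ξ)‖ :=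
            (norm_sub_le _ _).trans (by gcongr; exact norm_add_le _ _)
        _ ≤ δ / 8 * ‖ξ‖ + δ / 8 * ‖ξ‖ + δ / 8 * ‖ξ‖ := by gcongr
        _ = _ := by ring
    have h7 : ‖ξ‖ / 2 ≤ ‖q ξ‖ := by
      have : ξ = q ξ + (1 - q) ξ := by simp
      have h8 : ‖ξ‖ ≤ ‖q ξ‖ + ‖(1 - q) ξ‖ := by
        conv_lhs => rw [this]
        exact norm_add_le _ _
      nlinarith
    have h9 : ‖(1 - B) (q ξ)‖ ^ 2 ≤ (3 * δ / 8 * ‖ξ‖) ^ 2 := by gcongr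
    have h10 : (‖ξ‖ / 2) ^ 2 ≤ ‖q ξ‖ ^ 2 := by gcongr
    have h11 : δ ^ 2 * (‖ξ‖ / 2) ^ 2 ≤ δ ^ 2 * ‖q ξ‖ ^ 2 := by gcongr
    have h12 : 0 < δ ^ 2 * ‖ξ‖ ^ 2 := by positivity
    nlinarith
  · have h4 := hlow w
    rw [hw, hqfB] at h4
    refine le_of_sq_le_sq ?_ (by positivity)
    nlinarith

/-- A single off-diagonal block with a large expectation at a vector of the filter. -/
theorem IsExhaustion.exists_block {N : VonNeumannAlgebra H} (hN : IsFactor N)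
    {P : ℕ → H →L[ℂ] H} (hP : IsExhaustion N P) {F : Filter (H →L[ℂ] H)} (hF : IsGood N F)
    (hsmall : ∀ n, ∀ ε > 0, ∀ᶠ r in F, ‖P n * r‖ < ε) {A : Set (H →L[ℂ] H)} (hA : A ∈ F) (n : ℕ) :
    ∃ m l, n ≤ m ∧ m ≤ l ∧ n < l ∧ ∃ y ∈ N, ‖y‖ ≤ 1 ∧ (P l - P m) * y = y ∧
      y * (P m - P n) = y ∧ ∃ q ∈ A, ∃ ω, q ω = ω ∧ ω ≠ 0 ∧
        1 / 5 * ‖ω‖ ^ 2 ≤ quadForm y ω ∧ ‖(1 - (P l - P n)) ω‖ ≤ 1 / 10 * ‖ω‖ := by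
  obtain ⟨τ, -, hnear⟩ := hF.exists_near_mem hA
  obtain ⟨q, hq, hqA, -, hqF⟩ := hnear (1 / 100 / 8) (by norm_num) A hA
  obtain ⟨m, hnm, r, hr, hqr, hrB⟩ := hP.exists_block_projection hF hsmall hq
    (by norm_num : (0 : ℝ) < 1 / 100) (by norm_num) hqF n
  obtain ⟨l, hml, r', hr', hqr', hrB'⟩ := hP.exists_block_projection hF hsmall hq
    (by norm_num : (0 : ℝ) < 1 / 100) (by norm_num) hqF m
  set B := P m - P n with hB
  set B' := P l - P m with hB'
  have hBp : IsProjection B := hP.isProjection_sub hnm.le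
  have hB'p : IsProjection B' := hP.isProjection_sub hml.le
  have hBB' : B * B' = 0 := hP.sub_mul_sub hnm.le hml.le
  have hB'B : B' * B = 0 := by simpa [hBp.1, hB'p.1] using congrArg star hBB'
  have hBN : B ∈ N := sub_mem (hP.mem m) (hP.mem n)
  have hB'N : B' ∈ N := sub_mem (hP.mem l) (hP.mem m)
  obtain ⟨z, hz, hz0⟩ := hN.exists_mul_ne_zero hr.1 hr.2.2 hr'.2.2
  have hzpos : 0 < ‖r' * z * r‖ := norm_pos_iff.2 hz0
  set w : H →L[ℂ] H := ((‖r' * z * r‖⁻¹ : ℝ) : ℂ) • (r' * z * r) with hw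
  have hwN : w ∈ N := N.smul_mem' _ (mul_mem (mul_mem hr'.1 hz) hr.1)
  have hw1 : ‖w‖ = 1 := by
    rw [hw, norm_smul, Complex.norm_real, Real.norm_of_nonneg (by positivity)]
    field_simp
  have hwr : w * r = w := by rw [hw, smul_mul_assoc, mul_assoc _ r r, hr.2.1.2]
  have hrw : r' * w = w := by
    rw [hw, mul_smul_comm, ← mul_assoc, ← mul_assoc, hr'.2.1.2]
  obtain ⟨v, hv⟩ := exists_lt_norm_apply (T := w) (c := 99 / 100) (by norm_num)
    (by rw [hw1]; norm_num)
  set η := r v with hη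
  set η' := w η with hη'
  have hwle : ∀ u, ‖w u‖ ≤ ‖u‖ := fun u => by simpa using w.le_of_opNorm_le hw1.le u
  have hwη : w η = w v := DFunLike.congr_fun hwr v
  have hrη : r η = η := hr.2.1.apply_apply v
  have hrη' : r' η' = η' := DFunLike.congr_fun hrw η
  have hηv : ‖η‖ ≤ ‖v‖ := hr.2.1.norm_apply_le v
  have hη'1 : ‖η'‖ ≤ ‖η‖ := hwle η
  have hη'2 : 99 / 100 * ‖η‖ ≤ ‖η'‖ := by
    rw [hη', hwη]; nlinarith
  have hηpos : 0 < ‖η‖ := by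
    rcases (norm_nonneg η).eq_or_lt with h0 | h0
    · have h1 : w v = 0 := by rw [← hwη, norm_eq_zero.1 h0.symm, map_zero]
      rw [h1, norm_zero] at hv
      nlinarith [norm_nonneg v]
    · exact h0
  set ω := η + η' with hω
  have c1 : ‖(1 - B) η‖ ≤ 1 / 100 * ‖η‖ := hrB η hrη
  have c2 : ‖(1 - B') η'‖ ≤ 1 / 100 * ‖η‖ := (hrB' η' hrη').trans (by gcongr)
  have d1 : ‖B ω - η‖ ≤ 1 / 50 * ‖η‖ := by
    have e1 : B ω - η = B ((1 - B') η') - (1 - B) η := by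
      have : B (B' η') = 0 := DFunLike.congr_fun hBB' η'
      simp [hω, this]; abel
    rw [e1]
    have := (hBp.norm_apply_le ((1 - B') η')).trans c2
    linarith [norm_sub_le (B ((1 - B') η')) ((1 - B) η)]
  have d2 : ‖B' ω - η'‖ ≤ 1 / 50 * ‖η‖ := by
    have e1 : B' ω - η' = B' ((1 - B) η) - (1 - B') η' := by
      have : B' (B η) = 0 := DFunLike.congr_fun hB'B η
      simp [hω, this]; abel
    rw [e1]
    have := (hB'p.norm_apply_le ((1 - B) η)).trans c1
    linarith [norm_sub_le (B' ((1 - B) η)) ((1 - B') η')]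
  have hωup : ‖ω‖ ≤ 2 * ‖η‖ := by linarith [norm_add_le η η']
  have hωlow : 49 / 50 * ‖η‖ ≤ ‖ω‖ := by
    have h1 := hBp.norm_apply_le ω
    have h2 : ‖η‖ ≤ ‖B ω‖ + ‖B ω - η‖ := by
      have : η = B ω - (B ω - η) := by abel
      conv_lhs => rw [this]
      exact norm_sub_le _ _
    linarith
  have hωpos : 0 < ‖ω‖ := by linarith
  refine ⟨m, l, hnm.le, hml.le, hnm.trans hml, B' * w * B, mul_mem (mul_mem hB'N hwN) hBN, ?_, ?_,
    ?_, q, hqA, ω, ?_, norm_pos_iff.1 hωpos, ?_, ?_⟩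
  · calc ‖B' * w * B‖ ≤ ‖B'‖ * ‖w‖ * ‖B‖ :=
          (norm_mul_le _ _).trans (by gcongr; exact norm_mul_le _ _)
      _ ≤ 1 * 1 * 1 := by
          gcongr
          exacts [hB'p.norm_le_one, hw1.le, hBp.norm_le_one]
      _ = 1 := by norm_num
  · rw [← mul_assoc, ← mul_assoc, hB'p.2]
  · rw [mul_assoc, hBp.2]
  · have h1 : q η = η := by rw [← hrη]; exact DFunLike.congr_fun hqr η
    have h2 : q η' = η' := by rw [← hrη']; exact DFunLike.congr_fun hqr' η'
    rw [hω, map_add, h1, h2]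
  · have e1 : quadForm (B' * w * B) ω =
        ‖η'‖ ^ 2 + (⟪B' ω - η', w (B ω)⟫_ℂ).re + (⟪η', w (B ω - η)⟫_ℂ).re := by
      have h0 : (⟪η', η'⟫_ℂ).re = ‖η'‖ ^ 2 := (norm_sq_eq_re_inner (𝕜 := ℂ) η').symm
      rw [← h0, quadForm, opMul_apply, opMul_apply, ← hB'p.inner_apply, map_sub, inner_sub_left,
        inner_sub_right, Complex.sub_re, Complex.sub_re]
      ring
    have hBω : ‖B ω‖ ≤ 51 / 50 * ‖η‖ := by
      have : B ω = η + (B ω - η) := by abel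
      rw [this]
      linarith [norm_add_le η (B ω - η)]
    have b1 : |(⟪B' ω - η', w (B ω)⟫_ℂ).re| ≤ (1 / 50 * ‖η‖) * (51 / 50 * ‖η‖) :=
      (Complex.abs_re_le_norm _).trans ((norm_inner_le_norm _ _).trans
        (mul_le_mul d2 ((hwle _).trans hBω) (norm_nonneg _) (by positivity)))
    have b2 : |(⟪η', w (B ω - η)⟫_ℂ).re| ≤ ‖η‖ * (1 / 50 * ‖η‖) :=
      (Complex.abs_re_le_norm _).trans ((norm_inner_le_norm _ _).trans
        (mul_le_mul hη'1 ((hwle _).trans d1) (norm_nonneg _) (by positivity)))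
    have b3 : (99 / 100 * ‖η‖) ^ 2 ≤ ‖η'‖ ^ 2 := by gcongr
    have b4 : ‖ω‖ ^ 2 ≤ (2 * ‖η‖) ^ 2 := by gcongr
    have b5 := (abs_le.1 b1).1
    have b6 := (abs_le.1 b2).1
    rw [e1]
    nlinarith
  · have e1 : (1 - (P l - P n)) ω = -((B ω - η) + (B' ω - η')) := by
      simp [hB, hB', hω]; abel
    rw [e1, norm_neg]
    linarith [norm_add_le (B ω - η) (B' ω - η')]

/-- The filter witnesses that a state it defines is not a character vanishing on the exhaustion:
either some `P n` gets positive value, or some self-adjoint element which is off-diagonal with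
respect to a projection generated by the exhaustion does. -/
def Settles (N : VonNeumannAlgebra H) (G : Filter (H →L[ℂ] H)) (P : ℕ → H →L[ℂ] H) : Prop :=
  (∃ n, ∃ l : ℝ, 0 < l ∧ Decides G (P n) (l : ℂ)) ∨
  ∃ e x : H →L[ℂ] H, IsProjection e ∧ (∀ C : VonNeumannAlgebra H, (∀ n, P n ∈ C) → e ∈ C) ∧
    x ∈ N ∧ e * x * e = 0 ∧ (1 - e) * x * (1 - e) = 0 ∧
    ∃ l : ℝ, 0 < l ∧ Decides G x (l : ℂ)

theorem Settles.mono {N : VonNeumannAlgebra H} {F G : Filter (H →L[ℂ] H)} {P : ℕ → H →L[ℂ] H}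
    (h : Settles N F P) (hGF : G ≤ F) : Settles N G P := by
  rcases h with ⟨n, l, hl, h⟩ | ⟨e, x, he, heC, hx, h1, h2, l, hl, h⟩
  · exact Or.inl ⟨n, l, hl, h.mono hGF⟩
  · exact Or.inr ⟨e, x, he, heC, hx, h1, h2, l, hl, h.mono hGF⟩

/-- A countably generated good filter can be refined so as to settle a given exhaustion. -/
theorem IsGood.exists_settles {N : VonNeumannAlgebra H} (hN : IsFactor N)
    {F : Filter (H →L[ℂ] H)} (hF : IsGood N F) [hcg : F.IsCountablyGenerated]
    {P : ℕ → H →L[ℂ] H} (hP : IsExhaustion N P) :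
    ∃ G ≤ F, IsGood N G ∧ G.IsCountablyGenerated ∧ Settles N G P := by
  by_cases hsmall : ∀ n, ∀ ε > 0, ∀ᶠ r in F, ‖P n * r‖ < ε
  · obtain ⟨A, hA⟩ := F.exists_antitone_basis
    choose m k hm hmk hlt y hyN hy1 hy hy' q hqA ω hqω hω0 hω1 hω2 using
      fun i n => hP.exists_block hN hF hsmall (hA.mem i) n
    set κ : ℕ → ℕ := fun i => Nat.rec 0 (fun i n => k i n) i with hκ
    have hκs : ∀ i, κ (i + 1) = k i (κ i) := fun i => rfl
    have hmono : StrictMono κ := strictMono_nat_of_lt_succ fun i => by rw [hκs]; exact hlt _ _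
    obtain ⟨e, Y, he, heC, hYN, hY1, heY, hYe, hQY, hYQ⟩ :=
      hP.exists_offDiagonal hmono (m := fun i => m i (κ i)) (fun i => hm _ _)
        (fun i => hmk _ _) (y := fun i => y i (κ i)) (fun i => hyN _ _) (fun i => hy1 _ _)
        (fun i => hy _ _) (fun i => hy' _ _)
    have hxs : star (Y + star Y) = Y + star Y := by simp [add_comm]
    have hxN : Y + star Y ∈ N := add_mem hYN (star_mem hYN)
    obtain ⟨G, hGF, hG, hGc, l, hl, hlc⟩ := hF.exists_decides hxs hxN
    refine ⟨G, hGF, hG, hGc hcg, Or.inr ⟨e, Y + star Y, he, heC, hxN, ?_, ?_, l, ?_, hl⟩⟩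
    · have h1 : star Y * e = 0 := by simpa [he.1] using congrArg star heY
      rw [mul_add, add_mul, heY, mul_assoc e, h1]; simp
    · have h1 : (1 - e) * star Y = 0 := by simpa [he.1] using congrArg star hYe
      rw [mul_add, add_mul, mul_assoc, hYe, h1]; simp
    · refine lt_of_lt_of_le (by norm_num : (0 : ℝ) < 1 / 10) (hlc _ ?_)
      rw [frequently_iff]
      intro U hU
      obtain ⟨i, -, hi⟩ := hA.1.mem_iff.1 hU
      refine ⟨q i (κ i), hi (hqA i (κ i)), ω i (κ i), hqω _ _, hω0 _ _, ?_⟩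
      set v := ω i (κ i) with hv
      set Q := P (κ (i + 1)) - P (κ i) with hQ
      have hQp : IsProjection Q := hP.isProjection_sub (hmono.monotone i.le_succ)
      have hdec : Y = y i (κ i) + (1 - Q) * Y * (1 - Q) := by
        have h1 : Q * Y = y i (κ i) := hQY i
        have h2 : Y * Q = y i (κ i) := hYQ i
        have h3 : Q * Y * Q = y i (κ i) := by rw [mul_assoc, h2, ← h1, ← mul_assoc, hQp.2]
        have h4 : (1 - Q) * Y * (1 - Q) = Y - Q * Y - Y * Q + Q * Y * Q := by noncomm_ring
        rw [h4, h3, h1, h2]; abel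
      have e1 : quadForm (Y + star Y) v = 2 * quadForm Y v := by
        have h1 : (⟪v, star Y v⟫_ℂ).re = (⟪v, Y v⟫_ℂ).re := by
          rw [ContinuousLinearMap.star_eq_adjoint, ContinuousLinearMap.adjoint_inner_right]
          exact inner_re_symm (𝕜 := ℂ) _ _
        rw [quadForm, add_apply, inner_add_right, Complex.add_re, h1, quadForm]
        ring
      have e2 : quadForm Y v = quadForm (y i (κ i)) v + quadForm Y ((1 - Q) v) := by
        rw [← quadForm_compress hQp.one_sub]
        conv_lhs => rw [hdec]
        rw [quadForm, add_apply, inner_add_right, Complex.add_re]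
        rfl
      have h1 : 1 / 5 * ‖v‖ ^ 2 ≤ quadForm (y i (κ i)) v := hω1 _ _
      have h2 : ‖(1 - Q) v‖ ≤ 1 / 10 * ‖v‖ := hω2 _ _
      have h3 := (abs_le.1 (abs_quadForm_le Y ((1 - Q) v))).1
      have h4 : ‖(1 - Q) v‖ ^ 2 ≤ (1 / 10 * ‖v‖) ^ 2 := by gcongr
      have h5 : ‖Y‖ * ‖(1 - Q) v‖ ^ 2 ≤ 1 * ‖(1 - Q) v‖ ^ 2 := by gcongr
      rw [e1, e2]
      nlinarith [sq_nonneg ‖v‖]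
  · push Not at hsmall
    obtain ⟨n, ε, hε, hfr⟩ := hsmall
    obtain ⟨G, hGF, hG, hGc, l, hl, hlc⟩ := hF.exists_decides (hP.proj n).1 (hP.mem n)
    refine ⟨G, hGF, hG, hGc hcg, Or.inl ⟨n, l, ?_, hl⟩⟩
    refine lt_of_lt_of_le (by positivity : 0 < (ε / 2) ^ 2) (hlc _ ?_)
    refine (hfr.and_eventually hF.proj_mem).mono ?_
    rintro r ⟨hr, hrp⟩
    obtain ⟨v, hv⟩ := exists_lt_norm_apply (T := P n * r) (c := ε / 2) (by positivity)
      (by linarith)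
    refine ⟨r v, hrp.2.1.apply_apply v, ?_, ?_⟩
    · intro h0
      rw [opMul_apply, h0, map_zero, norm_zero] at hv
      have : 0 ≤ ε / 2 * ‖v‖ := by positivity
      linarith
    · rw [(hP.proj n).quadForm_self, ← mul_pow]
      have : ε / 2 * ‖r v‖ ≤ ‖P n (r v)‖ := by
        have h1 : ε / 2 * ‖r v‖ ≤ ε / 2 * ‖v‖ := by gcongr; exact hrp.2.1.norm_apply_le v
        exact h1.trans hv.le
      gcongr

/-! ### The initial filter -/

/-- An increasing sequence of projections converges strongly to a projection. -/
theorem exists_strong_limit {t : ℕ → H →L[ℂ] H} (ht : ∀ n, IsProjection (t n))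
    (hmono : ∀ n m, n ≤ m → t n * t m = t n) :
    ∃ T, IsProjection T ∧ (∀ C : VonNeumannAlgebra H, (∀ n, t n ∈ C) → T ∈ C) ∧
      (∀ n, T * t n = t n) ∧ (∀ n, t n * T = t n) ∧
      ∀ ξ, Tendsto (fun n => t n ξ) atTop (𝓝 (T ξ)) := by
  have hmono' : ∀ n m, n ≤ m → t m * t n = t n := fun n m h => by
    simpa [(ht n).1, (ht m).1] using congrArg star (hmono n m h)
  have hdist : ∀ ξ n m, n ≤ m → ‖t n ξ - t m ξ‖ ^ 2 = ‖t m ξ‖ ^ 2 - ‖t n ξ‖ ^ 2 := by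
    intro ξ n m h
    have h1 := (ht n).norm_sq_add (t m ξ)
    have h2 : t n (t m ξ) = t n ξ := DFunLike.congr_fun (hmono n m h) ξ
    rw [sub_apply, one_apply_eq_self, h2, norm_sub_rev] at h1
    linarith
  have hnm : ∀ ξ, Monotone fun n => ‖t n ξ‖ ^ 2 := fun ξ n m h => by
    have := hdist ξ n m h
    have h2 := sq_nonneg ‖t n ξ - t m ξ‖
    simp only
    linarith
  have hbdd : ∀ ξ, BddAbove (Set.range fun n => ‖t n ξ‖ ^ 2) := fun ξ => by
    refine ⟨‖ξ‖ ^ 2, ?_⟩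
    rintro _ ⟨n, rfl⟩
    have := (ht n).norm_apply_le ξ
    simp only
    gcongr
  have hcau : ∀ ξ, CauchySeq fun n => t n ξ := by
    intro ξ
    set L := ⨆ n, ‖t n ξ‖ ^ 2 with hL
    have hlim : Tendsto (fun n => ‖t n ξ‖ ^ 2) atTop (𝓝 L) := tendsto_atTop_ciSup (hnm ξ) (hbdd ξ)
    refine cauchySeq_of_le_tendsto_0' (fun n => Real.sqrt (L - ‖t n ξ‖ ^ 2)) (fun n m h => ?_) ?_
    · rw [dist_eq_norm]
      refine Real.le_sqrt_of_sq_le ?_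
      rw [hdist ξ n m h]
      linarith [le_ciSup (hbdd ξ) m]
    · have := (Real.continuous_sqrt.tendsto _).comp ((tendsto_const_nhds (x := L)).sub hlim)
      simpa [Function.comp_def] using this
  choose y hy using fun ξ => cauchySeq_tendsto_of_complete (hcau ξ)
  set T : H →L[ℂ] H := continuousLinearMapOfTendsto t (tendsto_pi_nhds.2 hy) with hT
  have hlim : ∀ ξ, Tendsto (fun n => t n ξ) atTop (𝓝 (T ξ)) := hy
  have hTt : ∀ n, T * t n = t n := fun n => by
    ext ξ
    refine tendsto_nhds_unique (hlim (t n ξ)) (tendsto_const_nhds.congr' ?_)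
    filter_upwards [eventually_ge_atTop n] with m hm
    exact (DFunLike.congr_fun (hmono' n m hm) ξ).symm
  have htT : ∀ n, t n * T = t n := fun n => by
    ext ξ
    have h1 : Tendsto (fun m => t n (t m ξ)) atTop (𝓝 (t n (T ξ))) :=
      ((t n).continuous.tendsto _).comp (hlim ξ)
    refine tendsto_nhds_unique h1 (tendsto_const_nhds.congr' ?_)
    filter_upwards [eventually_ge_atTop n] with m hm
    exact (DFunLike.congr_fun (hmono n m hm) ξ).symm
  refine ⟨T, ⟨?_, ?_⟩, ?_, hTt, htT, hlim⟩
  · rw [ContinuousLinearMap.star_eq_adjoint, eq_comm, ContinuousLinearMap.eq_adjoint_iff]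
    intro a b
    have h1 : Tendsto (fun n => ⟪t n a, b⟫_ℂ) atTop (𝓝 ⟪T a, b⟫_ℂ) :=
      (hlim a).inner tendsto_const_nhds
    have h2 : Tendsto (fun n => ⟪a, t n b⟫_ℂ) atTop (𝓝 ⟪a, T b⟫_ℂ) :=
      tendsto_const_nhds.inner (hlim b)
    exact tendsto_nhds_unique h1 (h2.congr fun n => ((ht n).inner_apply a b).symm)
  · ext ξ
    have h1 : Tendsto (fun n => T (t n ξ)) atTop (𝓝 (T (T ξ))) :=
      (T.continuous.tendsto _).comp (hlim ξ)
    exact tendsto_nhds_unique h1 ((hlim ξ).congr fun n => (DFunLike.congr_fun (hTt n) ξ).symm)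
  · intro C hC
    refine C.mem_of_commute fun w hw => ?_
    ext ξ
    have h1 : Tendsto (fun k => w (t k ξ)) atTop (𝓝 (w (T ξ))) :=
      (w.continuous.tendsto _).comp (hlim ξ)
    refine tendsto_nhds_unique h1 ((hlim (w ξ)).congr fun k => ?_)
    exact DFunLike.congr_fun (C.commute_of_mem (hC k) hw) ξ

/-- Corners between minimal projections are at most one-dimensional. -/
theorem exists_span_singleton_of_minimal (N : VonNeumannAlgebra H) {m m' : H →L[ℂ] H}
    (hm : IsMinimalProjectionIn (N : Set (H →L[ℂ] H)) m)
    (hm' : IsMinimalProjectionIn (N : Set (H →L[ℂ] H)) m') :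
    ∃ v : H →L[ℂ] H, ∀ x ∈ N, m * x * m' ∈ Submodule.span ℂ {v} := by
  by_cases h : ∃ a ∈ N, m * a * m' ≠ 0
  · obtain ⟨a, ha, ha0⟩ := h
    set v := m * a * m' with hv
    refine ⟨v, fun x hx => ?_⟩
    have hmN : m ∈ N := hm.1
    have hm'N : m' ∈ N := hm'.1
    have hsv : star v = m' * star a * m := by simp [hv, hm.2.1.1, hm'.2.1.1, mul_assoc]
    obtain ⟨c, hc⟩ := exists_eq_smul_of_minimal N hm'
      (mul_mem (mul_mem (star_mem ha) hmN) hx : star a * m * x ∈ N)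
    obtain ⟨d, hd⟩ := exists_eq_smul_of_minimal N hm
      (mul_mem (mul_mem ha hm'N) (star_mem ha) : a * m' * star a ∈ N)
    have hvv : v * star v = d • m := by
      rw [← hd, hsv, hv]
      simp only [mul_assoc]
      rw [← mul_assoc m' m', hm'.2.1.2]
    have hd0 : d ≠ 0 := by
      rintro rfl
      rw [zero_smul] at hvv
      exact ha0 ((CStarRing.mul_star_self_eq_zero_iff _).1 hvv)
    have h1 : star v * (m * x * m') = c • m' := by
      rw [← hc, hsv]
      simp only [mul_assoc]
      rw [← mul_assoc m m, hm.2.1.2]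
    have h2 : d • (m * x * m') = c • v := by
      have h3 : v * m' = v := by rw [hv, mul_assoc, hm'.2.1.2]
      calc d • (m * x * m') = (d • m) * (m * x * m') := by
            rw [smul_mul_assoc, ← mul_assoc, ← mul_assoc, hm.2.1.2]
        _ = v * (star v * (m * x * m')) := by rw [← hvv, mul_assoc]
        _ = c • v := by rw [h1, mul_smul_comm, h3]
    refine Submodule.mem_span_singleton.2 ⟨d⁻¹ * c, ?_⟩
    rw [mul_smul, ← h2, smul_smul, inv_mul_cancel₀ hd0, one_smul]
  · push Not at h
    exact ⟨0, fun x hx => by rw [h x hx]; exact zero_mem _⟩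

/-- A von Neumann algebra whose unit is a finite sum of minimal projections is
finite-dimensional. -/
theorem finiteDimensional_of_sum_minimal (N : VonNeumannAlgebra H) (l : List (H →L[ℂ] H))
    (hl : ∀ m ∈ l, IsMinimalProjectionIn (N : Set (H →L[ℂ] H)) m) (h1 : l.sum = 1) :
    FiniteDimensional ℂ ↥N := by
  classical
  have hv : ∀ m m' : H →L[ℂ] H, ∃ v : H →L[ℂ] H, m ∈ l → m' ∈ l →
      ∀ x ∈ N, m * x * m' ∈ Submodule.span ℂ {v} := by
    intro m m'
    by_cases hm : m ∈ l
    · by_cases hm' : m' ∈ l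
      · obtain ⟨v, hv⟩ := exists_span_singleton_of_minimal N (hl m hm) (hl m' hm')
        exact ⟨v, fun _ _ => hv⟩
      · exact ⟨0, fun _ h => absurd h hm'⟩
    · exact ⟨0, fun h => absurd h hm⟩
  choose v hv using hv
  set s : Set (H →L[ℂ] H) := (fun p : (H →L[ℂ] H) × (H →L[ℂ] H) => v p.1 p.2) ''
    ((l.toFinset ×ˢ l.toFinset : Finset _) : Set ((H →L[ℂ] H) × (H →L[ℂ] H))) with hs
  have hsfin : s.Finite := (Finset.finite_toSet _).image _
  set S := Submodule.span ℂ s with hS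
  have hSfin : FiniteDimensional ℂ S := FiniteDimensional.span_of_finite ℂ hsfin
  have hsum : ∀ φ : (H →L[ℂ] H) →+ (H →L[ℂ] H), (∀ m ∈ l, φ m ∈ S) → φ l.sum ∈ S := by
    intro φ h
    rw [map_list_sum]
    refine list_sum_mem fun z hz => ?_
    obtain ⟨m, hm, rfl⟩ := List.mem_map.1 hz
    exact h m hm
  have hmem : ∀ x ∈ N, x ∈ S := by
    intro x hx
    have hstep : ∀ m ∈ l, m * x * l.sum ∈ S := fun m hm =>
      hsum (AddMonoidHom.mulLeft (m * x)) fun m' hm' => by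
        refine Submodule.span_mono ?_ (hv m m' hm hm' x hx)
        rw [Set.singleton_subset_iff]
        exact ⟨(m, m'), by simp [hm, hm'], rfl⟩
    have h2 := hsum (AddMonoidHom.mulRight (x * l.sum)) fun m hm => by
      have := hstep m hm
      rwa [mul_assoc] at this
    simpa [h1] using h2
  let f : ↥N →ₗ[ℂ] S :=
    { toFun := fun x => ⟨x, hmem x x.2⟩
      map_add' := fun _ _ => rfl
      map_smul' := fun _ _ => rfl }
  exact FiniteDimensional.of_injective f fun a b h => Subtype.ext
    (congrArg (fun z : S => (z : H →L[ℂ] H)) h)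

/-- An infinite-dimensional von Neumann algebra contains a strictly decreasing sequence of
projections. -/
theorem exists_strictly_decreasing (N : VonNeumannAlgebra H) (hinf : ¬ FiniteDimensional ℂ ↥N) :
    ∃ s : ℕ → H →L[ℂ] H, (∀ n, s n ∈ N) ∧ (∀ n, IsProjection (s n)) ∧
      (∀ n, s n * s (n + 1) = s (n + 1)) ∧ ∀ n, s (n + 1) ≠ s n := by
  let lt : {p : H →L[ℂ] H // p ∈ N ∧ IsProjection p} →
      {p : H →L[ℂ] H // p ∈ N ∧ IsProjection p} → Prop :=
    fun p q => q.1 * p.1 = p.1 ∧ p.1 ≠ q.1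
  by_cases hwf : WellFounded lt
  · exfalso
    have hmin : ∀ p : {p : H →L[ℂ] H // p ∈ N ∧ IsProjection p}, p.1 ≠ 0 →
        ∃ m, IsMinimalProjectionIn (N : Set (H →L[ℂ] H)) m ∧ p.1 * m = m := by
      intro p hp0
      obtain ⟨m, ⟨hpm, hm0⟩, hmin⟩ := hwf.has_min
        {m | p.1 * m.1 = m.1 ∧ m.1 ≠ 0} ⟨p, p.2.2.2, hp0⟩
      refine ⟨m.1, ⟨m.2.1, m.2.2, hm0, fun q hq hqp hqm => ?_⟩, hpm⟩
      by_contra! hcon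
      refine hmin ⟨q, hq, hqp⟩ ⟨?_, hcon.1⟩ ⟨hqm.2, hcon.2⟩
      change p.1 * q = q
      rw [← hqm.2, ← mul_assoc, hpm]
    have hdec : ∀ p : {p : H →L[ℂ] H // p ∈ N ∧ IsProjection p}, ∃ l : List (H →L[ℂ] H),
        (∀ m ∈ l, IsMinimalProjectionIn (N : Set (H →L[ℂ] H)) m) ∧ l.sum = p.1 := by
      intro p
      induction p using hwf.induction with
      | _ p ih =>
        by_cases hp0 : p.1 = 0
        · exact ⟨[], by simp, by simp [hp0]⟩
        · obtain ⟨m, hm, hpm⟩ := hmin p hp0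
          have hmp := p.2.2.mul_eq_of_mul_eq hm.2.1 hpm
          obtain ⟨l, hl, hsum⟩ := ih ⟨p.1 - m, sub_mem p.2.1 hm.1, p.2.2.sub hm.2.1 hmp hpm⟩
            ⟨by change p.1 * (p.1 - m) = p.1 - m; rw [mul_sub, p.2.2.2, hpm],
              fun h => hm.2.2.1 (by simpa using h)⟩
          refine ⟨m :: l, ?_, ?_⟩
          · intro m' hm'
            rcases List.mem_cons.1 hm' with rfl | h
            · exact hm
            · exact hl m' h
          · rw [List.sum_cons, hsum]; simp
    obtain ⟨l, hl, hsum⟩ := hdec ⟨1, one_mem N, IsProjection.one⟩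
    exact hinf (finiteDimensional_of_sum_minimal N l hl hsum)
  · rw [wellFounded_iff_isEmpty_descending_chain, not_isEmpty_iff] at hwf
    obtain ⟨f, hf⟩ := hwf
    exact ⟨fun n => (f n).1, fun n => (f n).2.1, fun n => (f n).2.2, fun n => (hf n).1,
      fun n => (hf n).2⟩

/-- The initial filter, which concentrates on a sequence of projections decreasing strongly
to zero. -/
theorem exists_good_base (N : VonNeumannAlgebra H) (hinf : ¬ FiniteDimensional ℂ ↥N) :
    ∃ F : Filter (H →L[ℂ] H), IsGood N F ∧ F.IsCountablyGenerated ∧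
      ∃ e : ℕ → H →L[ℂ] H, (∀ n, e n ∈ nonzeroProj N) ∧
        (∀ ξ, Tendsto (fun n => e n ξ) atTop (𝓝 0)) ∧
        ∀ n, ∀ ε > 0, nearBelow N (e n) ε ∈ F := by
  obtain ⟨s, hsN, hsp, hsm, hsne⟩ := exists_strictly_decreasing N hinf
  have hs1 : ∀ n m, n ≤ m → s n * s m = s m := by
    intro n m h
    induction m, h using Nat.le_induction with
    | base => exact (hsp n).2
    | succ m _ ih => rw [← hsm m, ← mul_assoc, ih]
  set t : ℕ → H →L[ℂ] H := fun n => 1 - s n with ht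
  have htp : ∀ n, IsProjection (t n) := fun n => (hsp n).one_sub
  have htm : ∀ n m, n ≤ m → t n * t m = t n := fun n m h => by
    simp only [ht]
    rw [sub_mul, mul_sub, mul_sub, hs1 n m h]
    simp
  have htN : ∀ n, t n ∈ N := fun n => sub_mem (one_mem N) (hsN n)
  obtain ⟨T, hTp, hTC, hTt, htT, hlim⟩ := exists_strong_limit htp htm
  have hTN := hTC N htN
  set e : ℕ → H →L[ℂ] H := fun n => T - t n with he
  have hep : ∀ n, IsProjection (e n) := fun n => hTp.sub (htp n) (htT n) (hTt n)
  have he0 : ∀ n, e n ≠ 0 := by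
    intro n h0
    have h1 : T = t n := sub_eq_zero.1 h0
    have h2 := hTt (n + 1)
    rw [h1, htm n (n + 1) n.le_succ] at h2
    exact hsne n (sub_right_injective h2).symm
  have heP : ∀ n, e n ∈ nonzeroProj N := fun n => ⟨sub_mem hTN (htN n), hep n, he0 n⟩
  have hee : ∀ n m, n ≤ m → e n * e m = e m := fun n m h => by
    change (T - t n) * (T - t m) = T - t m
    rw [sub_mul, mul_sub T T (t m), mul_sub (t n) T (t m), hTp.2, hTt, htT, htm n m h, sub_self,
      sub_zero]
  set A : ℕ → Set (H →L[ℂ] H) := fun n => nearBelow N (e n) (1 / ((n : ℝ) + 1)) with hA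
  have hanti : Antitone A := fun n m h =>
    (nearBelow_subset_of_le (hep n) (hee n m h)).trans (nearBelow_mono
      (one_div_le_one_div_of_le (by positivity) (by exact_mod_cast Nat.succ_le_succ h)))
  have hdir : Directed (· ≥ ·) fun n => 𝓟 (A n) :=
    (show Antitone fun n => 𝓟 (A n) from fun _ _ h => principal_mono.2 (hanti h)).directed_ge
  have hnear : ∀ n, ∀ ε > 0, nearBelow N (e n) ε ∈ ⨅ n, 𝓟 (A n) := by
    intro n ε hε
    obtain ⟨k, hk⟩ := exists_nat_one_div_lt hε
    refine (mem_iInf_of_directed hdir _).2 ⟨max n k, mem_principal.2 ?_⟩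
    refine (nearBelow_subset_of_le (hep n) (hee n _ (le_max_left n k))).trans (nearBelow_mono ?_)
    refine le_trans (one_div_le_one_div_of_le (by positivity) ?_) hk.le
    exact_mod_cast Nat.succ_le_succ (le_max_right n k)
  refine ⟨⨅ n, 𝓟 (A n), ⟨?_, fun B hB => ?_⟩, inferInstance, e, heP, fun ξ => ?_, hnear⟩
  · exact mem_of_superset (hnear 0 1 one_pos) fun r hr => hr.1
  · obtain ⟨n, hn⟩ := (mem_iInf_of_directed hdir _).1 hB
    exact ⟨1 / ((n : ℝ) + 1), by positivity, fun τ' hτ' =>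
      ⟨e n, heP n, mem_principal.1 hn, hnear n τ' hτ'⟩⟩
  · have := (tendsto_const_nhds (x := T ξ)).sub (hlim ξ)
    rw [sub_self] at this
    exact this

/-! ### Transfinite recursion -/

/-- A chain of refinements of length at most `ω₁`, starting from a countably generated good
filter, has a good lower bound. -/
theorem exists_good_refinement {ι : Type*} [LinearOrder ι] [WellFoundedLT ι]
    (hι : ∀ i : ι, (Set.Iio i).Countable) {N : VonNeumannAlgebra H} {F : Filter (H →L[ℂ] H)}
    (hF : IsGood N F) (hFc : F.IsCountablyGenerated) (Q : ι → Filter (H →L[ℂ] H) → Prop)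
    (hstep : ∀ i G, IsGood N G → G.IsCountablyGenerated →
      ∃ G' ≤ G, IsGood N G' ∧ G'.IsCountablyGenerated ∧ Q i G') :
    ∃ G ≤ F, IsGood N G ∧ ∀ i, ∃ G', G ≤ G' ∧ Q i G' := by
  have hext : ∀ i G, ∃ G' ≤ G, IsGood N G → G.IsCountablyGenerated →
      IsGood N G' ∧ G'.IsCountablyGenerated ∧ Q i G' := by
    intro i G
    by_cases hG : IsGood N G ∧ G.IsCountablyGenerated
    · obtain ⟨G', hle, h⟩ := hstep i G hG.1 hG.2
      exact ⟨G', hle, fun _ _ => h⟩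
    · exact ⟨G, le_rfl, fun h h' => absurd ⟨h, h'⟩ hG⟩
  choose ext hext_le hext using hext
  obtain ⟨g, hg⟩ : ∃ g : ι → Filter (H →L[ℂ] H), ∀ i,
      g i = ext i (⨅ o : Option (Set.Iio i), o.elim F fun j => g j) :=
    ⟨(wellFounded_lt (α := ι)).fix fun i rec =>
        ext i (⨅ o : Option (Set.Iio i), o.elim F fun j => rec j.1 j.2),
      fun i => (wellFounded_lt (α := ι)).fix_eq _ i⟩
  have hle : ∀ i, g i ≤ ⨅ o : Option (Set.Iio i), o.elim F fun j => g j := fun i =>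
    (hg i).le.trans (hext_le i _)
  have hleF : ∀ i, g i ≤ F := fun i => (hle i).trans (iInf_le _ none)
  have hanti : ∀ i j, i ≤ j → g j ≤ g i := by
    intro i j h
    rcases h.eq_or_lt with rfl | h
    · exact le_rfl
    · exact (hle j).trans (iInf_le (fun o : Option (Set.Iio j) => o.elim F fun k => g k)
        (some ⟨i, h⟩))
  have hdir : ∀ s : Set ι, Directed (· ≥ ·) fun o : Option s => o.elim F fun j => g j := by
    rintro s (_ | i) (_ | j)
    · exact ⟨none, le_rfl, le_rfl⟩
    · exact ⟨some j, hleF j, le_rfl⟩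
    · exact ⟨some i, le_rfl, hleF i⟩
    · rcases le_total i.1 j.1 with h | h
      · exact ⟨some j, hanti _ _ h, le_rfl⟩
      · exact ⟨some i, le_rfl, hanti _ _ h⟩
  have hgood : ∀ i, IsGood N (g i) ∧ (g i).IsCountablyGenerated ∧ Q i (g i) := by
    intro i
    induction i using WellFoundedLT.induction with
    | _ i ih =>
      rw [hg i]
      have := (hι i).to_subtype
      refine hext i _ (IsGood.iInf (hdir _) ?_) ?_
      · rintro (_ | j)
        · exact hF
        · exact (ih j j.2).1
      · have : ∀ o : Option (Set.Iio i),
            (o.elim F fun j => g j : Filter (H →L[ℂ] H)).IsCountablyGenerated := by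
          rintro (_ | j)
          · exact hFc
          · exact (ih j j.2).2.1
        infer_instance
  refine ⟨⨅ o : Option (Set.univ : Set ι), o.elim F fun j => g j, iInf_le _ none,
    IsGood.iInf (hdir _) ?_, fun i => ⟨g i, ?_, (hgood i).2.2⟩⟩
  · rintro (_ | j)
    · exact hF
    · exact (hgood j).1
  · exact iInf_le (fun o : Option (Set.univ : Set ι) => o.elim F fun j => g j)
      (some ⟨i, Set.mem_univ i⟩)

/-- Under the continuum hypothesis, the sequences of operators on a separable Hilbert space can
be enumerated by the countable ordinals. -/
theorem exists_surjective_of_CH (CH : (2 : Cardinal.{0}) ^ Cardinal.aleph0 = Cardinal.aleph 1)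
    (H : Type*) [NormedAddCommGroup H] [InnerProductSpace ℂ H]
    [TopologicalSpace.SeparableSpace H] :
    ∃ φ : (Cardinal.aleph 1 : Cardinal.{0}).ord.ToType → ℕ → H →L[ℂ] H,
      Function.Surjective φ := by
  set d := TopologicalSpace.denseSeq H with hd
  have hdense : DenseRange d := TopologicalSpace.denseRange_denseSeq H
  let j : (ℕ → H →L[ℂ] H) → ℕ × ℕ × ℕ → ℝ := fun t k => dist (t k.1 (d k.2.1)) (d k.2.2)
  have hj : Function.Injective j := by
    intro t t' h
    funext n
    refine ContinuousLinearMap.coeFn_injective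
      (hdense.equalizer (t n).continuous (t' n).continuous (funext fun k => ?_))
    have h1 : (fun z => dist (t n (d k)) z) = fun z => dist (t' n (d k)) z :=
      hdense.equalizer (by fun_prop) (by fun_prop)
        (funext fun l => congrFun h (n, k, l))
    have h2 := congrFun h1 (t' n (d k))
    simp only [dist_self] at h2
    exact dist_eq_zero.1 h2
  have hcard : Cardinal.mk (ℕ × ℕ × ℕ → ℝ) =
      Cardinal.mk (Cardinal.aleph 1 : Cardinal.{0}).ord.ToType := by
    rw [Cardinal.mk_ord_toType, ← CH, Cardinal.mk_arrow]
    simp [Cardinal.mk_real]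
  obtain ⟨e⟩ := Cardinal.eq.1 hcard
  exact ⟨Function.invFun fun t => e (j t), Function.invFun_surjective (e.injective.comp hj)⟩

/-- Under the continuum hypothesis, every countably generated good filter can be refined to a
good filter that decides every operator of `N` and settles every exhaustion. -/
theorem IsGood.exists_complete_refinement
    (CH : (2 : Cardinal.{0}) ^ Cardinal.aleph0 = Cardinal.aleph 1)
    [TopologicalSpace.SeparableSpace H] {N : VonNeumannAlgebra H} (hN : IsFactor N)
    {F : Filter (H →L[ℂ] H)} (hF : IsGood N F) (hFc : F.IsCountablyGenerated) :
    ∃ G ≤ F, IsGood N G ∧ (∀ x ∈ N, star x = x → ∃ l : ℝ, Decides G x (l : ℂ)) ∧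
      ∀ P, IsExhaustion N P → Settles N G P := by
  obtain ⟨φ, hφ⟩ := exists_surjective_of_CH CH H
  have hι (i : (Cardinal.aleph 1 : Cardinal.{0}).ord.ToType) : (Set.Iio i).Countable := by
    rw [← Cardinal.le_aleph0_iff_set_countable, ← Order.lt_succ_iff, Cardinal.succ_aleph0]
    simpa using Cardinal.mk_Iio_lt i (by simp)
  have hstep : ∀ i G, IsGood N G → G.IsCountablyGenerated →
      ∃ G' ≤ G, IsGood N G' ∧ G'.IsCountablyGenerated ∧
        (φ i 0 ∈ N → star (φ i 0) = φ i 0 → ∃ l : ℝ, Decides G' (φ i 0) (l : ℂ)) ∧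
          (IsExhaustion N (φ i) → Settles N G' (φ i)) := by
    intro i G hG hGc
    obtain ⟨G₁, hle₁, hG₁, hGc₁, h₁⟩ : ∃ G₁ ≤ G, IsGood N G₁ ∧ G₁.IsCountablyGenerated ∧
        (φ i 0 ∈ N → star (φ i 0) = φ i 0 → ∃ l : ℝ, Decides G₁ (φ i 0) (l : ℂ)) := by
      by_cases h : φ i 0 ∈ N ∧ star (φ i 0) = φ i 0
      · obtain ⟨G₁, hle, hG₁, hc, l, hl, -⟩ := hG.exists_decides h.2 h.1
        exact ⟨G₁, hle, hG₁, hc hGc, fun _ _ => ⟨l, hl⟩⟩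
      · exact ⟨G, le_rfl, hG, hGc, fun h1 h2 => absurd ⟨h1, h2⟩ h⟩
    by_cases hP : IsExhaustion N (φ i)
    · obtain ⟨G₂, hle₂, hG₂, hGc₂, h₂⟩ := hG₁.exists_settles hN hP
      refine ⟨G₂, hle₂.trans hle₁, hG₂, hGc₂, fun hx hs => ?_, fun _ => h₂⟩
      obtain ⟨l, hl⟩ := h₁ hx hs
      exact ⟨l, hl.mono hle₂⟩
    · exact ⟨G₁, hle₁, hG₁, hGc₁, h₁, fun h => absurd h hP⟩
  obtain ⟨G, hGF, hG, hQ⟩ := exists_good_refinement hι hF hFc _ hstep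
  refine ⟨G, hGF, hG, fun x hxN hx => ?_, fun P hP => ?_⟩
  · obtain ⟨i, hi⟩ := hφ fun _ => x
    obtain ⟨G', hle, h, -⟩ := hQ i
    rw [hi] at h
    obtain ⟨l, hl⟩ := h hxN hx
    exact ⟨l, hl.mono hle⟩
  · obtain ⟨i, rfl⟩ := hφ P
    obtain ⟨G', hle, -, h⟩ := hQ i
    exact (h hP).mono hle

/-! ### Positive functionals -/

namespace IsPosFunctional

variable {M : VonNeumannAlgebra H} {g : ↥M →ₗ[ℂ] ℂ}

theorem re_nonneg (hg : IsPosFunctional M g) (a : ↥M) : 0 ≤ (g (star a * a)).re :=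
  (Complex.nonneg_iff.1 (hg a)).1

theorem im_eq_zero (hg : IsPosFunctional M g) (a : ↥M) : (g (star a * a)).im = 0 :=
  (Complex.nonneg_iff.1 (hg a)).2.symm

theorem conj_map_star_mul (hg : IsPosFunctional M g) (a b : ↥M) :
    (starRingEnd ℂ) (g (star b * a)) = g (star a * b) := by
  have hI : star (Complex.I • b) = -(Complex.I • star b) := by
    rw [star_smul]; simp
  have h1 := hg.im_eq_zero (a + b)
  have h2 := hg.im_eq_zero (a + Complex.I • b)
  have ha := hg.im_eq_zero a
  have hb := hg.im_eq_zero b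
  rw [star_add, add_mul, mul_add, mul_add, map_add, map_add, map_add] at h1
  rw [star_add, hI, add_mul, mul_add, mul_add, neg_mul, neg_mul, mul_smul_comm, smul_mul_assoc,
    smul_mul_assoc, mul_smul_comm, smul_smul, Complex.I_mul_I] at h2
  simp only [map_add, map_neg, map_smul, smul_eq_mul, neg_smul, one_smul, neg_neg,
    Complex.add_im, Complex.neg_im, Complex.I_mul_im] at h1 h2
  refine Complex.ext ?_ ?_
  · rw [Complex.conj_re]; linarith
  · rw [Complex.conj_im]; linarith

/-- The Cauchy–Schwarz inequality. -/
theorem norm_map_star_mul_sq_le (hg : IsPosFunctional M g) (a b : ↥M) :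
    ‖g (star a * b)‖ ^ 2 ≤ (g (star a * a)).re * (g (star b * b)).re := by
  let c : PreInnerProductSpace.Core ℂ ↥M :=
    { inner := fun x y => g (star x * y)
      conj_inner_symm := fun x y => hg.conj_map_star_mul x y
      re_inner_nonneg := fun x => hg.re_nonneg x
      add_left := fun x y z => by simp [add_mul]
      smul_left := fun x y r => by simp [star_smul] }
  have h := InnerProductSpace.Core.inner_mul_inner_self_le (c := c) a b
  have h2 : ‖g (star b * a)‖ = ‖g (star a * b)‖ := by
    rw [← hg.conj_map_star_mul a b, RCLike.norm_conj]
  change ‖g (star a * b)‖ * ‖g (star b * a)‖ ≤ _ at h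
  rw [h2, ← sq] at h
  exact h

theorem map_star_mul_eq_zero (hg : IsPosFunctional M g) {a : ↥M} (ha : g (star a * a) = 0)
    (b : ↥M) : g (star a * b) = 0 := by
  have h := hg.norm_map_star_mul_sq_le a b
  rw [ha, Complex.zero_re, zero_mul] at h
  exact norm_eq_zero.1 (pow_eq_zero_iff two_ne_zero |>.1 (le_antisymm h (sq_nonneg _)))

theorem map_mul_eq_zero (hg : IsPosFunctional M g) {a : ↥M} (ha : g (star a * a) = 0)
    (b : ↥M) : g (b * a) = 0 := by
  have h := hg.conj_map_star_mul (star b) a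
  rwa [hg.map_star_mul_eq_zero ha, map_zero, star_star, eq_comm] at h

theorem map_one_nonneg (hg : IsPosFunctional M g) : 0 ≤ (g 1).re := by
  simpa using hg.re_nonneg 1

theorem map_one_eq (hg : IsPosFunctional M g) : g 1 = ((g 1).re : ℂ) := by
  refine Complex.ext rfl ?_
  simpa using hg.im_eq_zero 1

theorem re_map_star_mul_self_le (hg : IsPosFunctional M g) (a : ↥M) :
    (g (star a * a)).re ≤ ‖(a : H →L[ℂ] H)‖ ^ 2 * (g 1).re := by
  set x : H →L[ℂ] H := algebraMap ℝ _ (‖(a : H →L[ℂ] H)‖ ^ 2) - star (a : H →L[ℂ] H) * a with hx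
  have hx0 : 0 ≤ x := sub_nonneg.2 CStarAlgebra.star_mul_le_algebraMap_norm_sq
  have halg : (algebraMap ℝ (H →L[ℂ] H) (‖(a : H →L[ℂ] H)‖ ^ 2)) =
      ((‖(a : H →L[ℂ] H)‖ ^ 2 : ℝ) : ℂ) • (1 : H →L[ℂ] H) := by
    rw [Algebra.algebraMap_eq_smul_one, Complex.coe_smul]
  have hxM : x ∈ M := by
    rw [hx, halg]
    exact sub_mem (M.smul_mem' _ (one_mem M)) (mul_mem (star_mem a.2) a.2)
  let s : ↥M := ⟨CFC.sqrt x, M.sqrt_mem hxM⟩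
  have hs : star s * s = ((‖(a : H →L[ℂ] H)‖ ^ 2 : ℝ) : ℂ) • (1 : ↥M) - star a * a := by
    refine Subtype.ext ?_
    change star (CFC.sqrt x) * CFC.sqrt x = _
    rw [(CFC.sqrt_nonneg x).isSelfAdjoint.star_eq, CFC.sqrt_mul_sqrt_self x hx0, hx, halg]
    rfl
  have h := hg.re_nonneg s
  rw [hs, map_sub, map_smul, smul_eq_mul, Complex.sub_re, Complex.re_ofReal_mul] at h
  linarith

theorem norm_map_le (hg : IsPosFunctional M g) (a : ↥M) :
    ‖g a‖ ≤ (g 1).re * ‖(a : H →L[ℂ] H)‖ := by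
  have h := hg.norm_map_star_mul_sq_le 1 a
  rw [star_one, one_mul, one_mul] at h
  have h2 := hg.re_map_star_mul_self_le a
  have h0 := hg.map_one_nonneg
  refine le_of_sq_le_sq (h.trans ?_) (by positivity)
  nlinarith

end IsPosFunctional

/-! ### The σ-weak topology -/

theorem tendsto_sigmaWeak_zero {e : ℕ → H →L[ℂ] H} (he : ∀ n, ‖e n‖ ≤ 1)
    (hlim : ∀ ξ, Tendsto (fun n => e n ξ) atTop (𝓝 0)) :
    Tendsto e atTop (@nhds _ (sigmaWeak H) 0) := by
  rw [sigmaWeak, nhds_iInf, tendsto_iInf]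
  intro ξ
  rw [nhds_iInf, tendsto_iInf]
  intro η
  rw [nhds_iInf, tendsto_iInf]
  intro hξ
  rw [nhds_iInf, tendsto_iInf]
  intro hη
  rw [nhds_induced, tendsto_comap_iff]
  have hb : Summable fun k => ‖ξ k‖ ^ 2 + ‖η k‖ ^ 2 := hξ.add hη
  refine tendsto_tsum_of_dominated_convergence hb (fun k => ?_) (.of_forall fun n k => ?_)
  · simpa using tendsto_const_nhds.inner (hlim (η k))
  · have h1 : ‖e n (η k)‖ ≤ ‖η k‖ := by
      simpa using (e n).le_of_opNorm_le (he n) (η k)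
    have h2 := norm_inner_le_norm (𝕜 := ℂ) (ξ k) (e n (η k))
    nlinarith [norm_nonneg (ξ k), norm_nonneg (η k), sq_nonneg (‖ξ k‖ - ‖η k‖)]

theorem continuous_sigmaWeak_inner (ξ η : H) :
    @Continuous _ _ (sigmaWeak H) _ fun x : H →L[ℂ] H => ⟪ξ, x η⟫_ℂ := by
  have hs : ∀ ζ : H, Summable fun n => ‖(Pi.single 0 ζ : ℕ → H) n‖ ^ 2 := fun ζ =>
    summable_of_ne_finset_zero (s := {0}) fun n hn => by
      rw [Pi.single_eq_of_ne (by simpa using hn)]; simp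
  have h : (fun x : H →L[ℂ] H => ⟪ξ, x η⟫_ℂ) = fun x : H →L[ℂ] H =>
      ∑' n, ⟪(Pi.single 0 ξ : ℕ → H) n, x ((Pi.single 0 η : ℕ → H) n)⟫_ℂ := by
    funext x
    rw [tsum_eq_single 0 fun n hn => by simp [Pi.single_eq_of_ne hn]]
    simp
  rw [h, continuous_iff_le_induced]
  exact (iInf_le_of_le (Pi.single 0 ξ) <| iInf_le_of_le (Pi.single 0 η) <|
    iInf_le_of_le (hs ξ) <| iInf_le_of_le (hs η) le_rfl)

/-! ### The functional determined by a filter -/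

theorem IsProjection.exists_unit {p : H →L[ℂ] H} (hp : IsProjection p) (hp0 : p ≠ 0) :
    ∃ ξ, ‖ξ‖ = 1 ∧ p ξ = ξ := by
  obtain ⟨η, hη⟩ := IsProjection.exists_apply_ne_zero hp0
  refine ⟨((‖p η‖⁻¹ : ℝ) : ℂ) • p η, ?_, by rw [map_smul, hp.apply_apply]⟩
  rw [norm_smul, Complex.norm_real, norm_inv, norm_norm, inv_mul_cancel₀ (norm_ne_zero_iff.2 hη)]

namespace Decides

variable {N : VonNeumannAlgebra H} {F : Filter (H →L[ℂ] H)} {x y : H →L[ℂ] H} {c d : ℂ}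

theorem add (hx : Decides F x c) (hy : Decides F y d) : Decides F (x + y) (c + d) := by
  refine squeeze_zero (fun _ => norm_nonneg _) (fun r => ?_) (by simpa using Tendsto.add hx hy)
  have : r * (x + y - (c + d) • 1) * r = r * (x - c • 1) * r + r * (y - d • 1) * r := by
    rw [add_smul]; noncomm_ring
  rw [this]
  exact norm_add_le _ _

theorem smul (hx : Decides F x c) (a : ℂ) : Decides F (a • x) (a * c) := by
  have h : ∀ r, ‖r * (a • x - (a * c) • 1) * r‖ = ‖a‖ * ‖r * (x - c • 1) * r‖ := fun r => by
    rw [mul_smul, ← smul_sub, mul_smul_comm, smul_mul_assoc, norm_smul]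
  simpa only [Decides, h, mul_zero] using Tendsto.const_mul ‖a‖ hx

theorem one : Decides F 1 1 := by
  simpa [Decides] using tendsto_const_nhds

/-- The value decided for `x` lies in every closed set that eventually contains the
corresponding vector states. -/
theorem mem_of_isClosed (hF : IsGood N F) (hx : Decides F x c) {S : Set ℂ} (hS : IsClosed S)
    {A : Set (H →L[ℂ] H)} (hA : A ∈ F)
    (h : ∀ r ∈ A, ∀ ξ, ‖ξ‖ = 1 → r ξ = ξ → ⟪ξ, x ξ⟫_ℂ ∈ S) : c ∈ S := by
  have := hF.neBot
  rw [← hS.closure_eq, Metric.mem_closure_iff]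
  intro δ hδ
  obtain ⟨r, ⟨hrA, hr⟩, hrδ⟩ := (inter_mem (inter_mem hA hF.proj_mem)
    (hx.eventually_lt_const hδ) : _ ∩ {r | ‖r * (x - c • 1) * r‖ < δ} ∈ F) |> F.nonempty_of_mem
  obtain ⟨ξ, hξ, hrξ⟩ := hr.2.1.exists_unit hr.2.2
  refine ⟨_, h r hrA ξ hξ hrξ, ?_⟩
  have h1 : ⟪ξ, (r * (x - c • 1) * r) ξ⟫_ℂ = ⟪ξ, x ξ⟫_ℂ - c := by
    rw [opMul_apply, opMul_apply, hrξ, ← hr.2.1.inner_apply, hrξ]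
    simp [hξ]
  rw [dist_comm, dist_eq_norm, ← h1]
  refine lt_of_le_of_lt ?_ hrδ
  refine (norm_inner_le_norm _ _).trans ?_
  rw [hξ, one_mul]
  simpa [hξ] using (r * (x - c • 1) * r).le_opNorm ξ

theorem unique (hF : IsGood N F) (hx : Decides F x c) (hy : Decides F x d) : c = d := by
  have h : Decides F 0 (c + -1 * d) := by simpa using hx.add (hy.smul (-1))
  have := h.mem_of_isClosed hF (isClosed_singleton (x := (0 : ℂ))) univ_mem (by simp)
  rw [Set.mem_singleton_iff, neg_one_mul] at this
  exact add_neg_eq_zero.1 this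

end Decides

/-- The functional determined by a good filter that decides all self-adjoint operators. -/
theorem IsGood.exists_functional {N : VonNeumannAlgebra H} {F : Filter (H →L[ℂ] H)}
    (hF : IsGood N F) (hdec : ∀ x ∈ N, star x = x → ∃ l : ℝ, Decides F x (l : ℂ)) :
    ∃ f : ↥N →ₗ[ℂ] ℂ, ∀ x : ↥N, Decides F x (f x) := by
  have hall : ∀ x : ↥N, ∃ c, Decides F x c := by
    intro x
    obtain ⟨a, ha⟩ := hdec (x + star x) (add_mem x.2 (star_mem x.2)) (by simp [add_comm])
    obtain ⟨b, hb⟩ := hdec (Complex.I • (x - star x))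
      (N.smul_mem' _ (sub_mem x.2 (star_mem x.2))) (by rw [star_smul]; simp [← smul_neg])
    have h := (ha.smul (1 / 2)).add (hb.smul (-Complex.I / 2))
    have hx : (1 / 2 : ℂ) • ((x : H →L[ℂ] H) + star (x : H →L[ℂ] H)) +
        (-Complex.I / 2) • (Complex.I • ((x : H →L[ℂ] H) - star (x : H →L[ℂ] H))) = x := by
      have hI : -Complex.I / 2 * Complex.I = 1 / 2 := by
        rw [div_mul_eq_mul_div, neg_mul, Complex.I_mul_I, neg_neg]
      rw [smul_smul, hI]
      module
    exact ⟨_, hx ▸ h⟩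
  choose f hf using hall
  exact ⟨{ toFun := f
           map_add' := fun x y => (hf (x + y)).unique hF ((hf x).add (hf y))
           map_smul' := fun c x => (hf (c • x)).unique hF ((hf x).smul c) }, hf⟩

section State

variable {N : VonNeumannAlgebra H} {F : Filter (H →L[ℂ] H)} {f : ↥N →ₗ[ℂ] ℂ}

theorem isStateOn_of_decides (hF : IsGood N F) (hf : ∀ x : ↥N, Decides F x (f x)) :
    IsStateOn N f := by
  refine ⟨fun a => ?_, (hf 1).unique hF Decides.one⟩
  refine (hf (star a * a)).mem_of_isClosed hF (S := {z | 0 ≤ z}) isClosed_Ici univ_mem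
    fun r _ ξ _ _ => ?_
  have h : ⟪ξ, ((star a * a : ↥N) : H →L[ℂ] H) ξ⟫_ℂ = ⟪(a : H →L[ℂ] H) ξ, (a : H →L[ℂ] H) ξ⟫_ℂ :=
    ContinuousLinearMap.adjoint_inner_right (a : H →L[ℂ] H) ξ ((a : H →L[ℂ] H) ξ)
  rw [Set.mem_ofPred_eq, h, inner_self_eq_norm_sq_to_K]
  exact pow_nonneg (Complex.zero_le_real.2 (norm_nonneg ((a : H →L[ℂ] H) ξ))) 2

/-- A projection of `N` viewed as an element of `N` is its own square. -/
theorem star_mul_self_of_isProjection {p : ↥N} (hp : IsProjection (p : H →L[ℂ] H)) :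
    star p * p = p := by
  refine Subtype.ext ?_
  change star (p : H →L[ℂ] H) * p = p
  rw [hp.1, hp.2]

theorem isProjection_coe_one_sub {p : ↥N} (hp : IsProjection (p : H →L[ℂ] H)) :
    IsProjection ((1 - p : ↥N) : H →L[ℂ] H) := by
  have h : ((1 - p : ↥N) : H →L[ℂ] H) = 1 - (p : H →L[ℂ] H) := rfl
  rw [h]
  exact hp.one_sub

theorem re_map_one_sub_le (hF : IsGood N F) (hf : ∀ x : ↥N, Decides F x (f x)) {q : ↥N}
    (hq : IsProjection (q : H →L[ℂ] H)) {ε : ℝ} (h : nearBelow N q ε ∈ F) :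
    (f (1 - q)).re ≤ ε ^ 2 := by
  refine (hf (1 - q)).mem_of_isClosed hF (S := {z | z.re ≤ ε ^ 2})
    (isClosed_le Complex.continuous_re continuous_const) h fun r hr ξ hξ hrξ => ?_
  change quadForm (1 - q : H →L[ℂ] H) ξ ≤ ε ^ 2
  rw [hq.one_sub.quadForm_self]
  have := norm_apply_le_of_mem_nearBelow hr hrξ
  rw [hξ, mul_one] at this
  gcongr

theorem isPureStateOn_of_decides (hF : IsGood N F) (hf : ∀ x : ↥N, Decides F x (f x)) :
    IsPureStateOn N f := by
  have hst := isStateOn_of_decides hF hf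
  refine ⟨hst, fun g hg hfg => ⟨(g 1).re, hg.map_one_nonneg, LinearMap.ext fun x => ?_⟩⟩
  set y : ↥N := x - f x • 1 with hy
  suffices h : g y = 0 by
    rw [hy, map_sub, map_smul, sub_eq_zero] at h
    rw [h, LinearMap.smul_apply, ← hg.map_one_eq, smul_eq_mul, smul_eq_mul, mul_comm]
  set γ := (g 1).re with hγ
  have hγ0 : 0 ≤ γ := hg.map_one_nonneg
  set K := 2 * (Real.sqrt γ * ‖(y : H →L[ℂ] H)‖) + γ with hK
  have hK0 : 0 ≤ K := by positivity
  have hbound : ∀ δ > 0, ‖g y‖ ≤ K * δ := by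
    intro δ hδ
    obtain ⟨τ, -, hτ⟩ := hF.exists_near_mem hF.proj_mem
    obtain ⟨q, hqP, hqδ, -, hqF⟩ := hτ δ hδ _ ((hf x).eventually_lt_const hδ)
    lift q to ↥N using hqP.1
    have hq := hqP.2.1
    have hgq : (g (star (1 - q) * (1 - q))).re ≤ δ ^ 2 := by
      have h1 := hfg.re_nonneg (1 - q)
      rw [star_mul_self_of_isProjection (isProjection_coe_one_sub hq)] at h1 ⊢
      rw [LinearMap.sub_apply, Complex.sub_re] at h1
      linarith [re_map_one_sub_le hF hf hq hqF]
    have hgq0 := hg.re_nonneg (1 - q)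
    have hcs : ∀ z : ↥N, ‖(z : H →L[ℂ] H)‖ ≤ ‖(y : H →L[ℂ] H)‖ →
        (g (star (1 - q) * (1 - q))).re * (g (star z * z)).re ≤
          (Real.sqrt γ * ‖(y : H →L[ℂ] H)‖ * δ) ^ 2 := by
      intro z hz
      have h1 : (g (star z * z)).re ≤ ‖(y : H →L[ℂ] H)‖ ^ 2 * γ :=
        (hg.re_map_star_mul_self_le z).trans (by gcongr)
      calc _ ≤ δ ^ 2 * (‖(y : H →L[ℂ] H)‖ ^ 2 * γ) :=
            mul_le_mul hgq h1 (hg.re_nonneg z) (sq_nonneg _)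
        _ = _ := by rw [mul_pow, mul_pow, Real.sq_sqrt hγ0]; ring
    have hdec : y = y * (1 - q) + star (1 - q) * (y * q) + q * y * q := by
      have : star (1 - q) = 1 - q := Subtype.ext (isProjection_coe_one_sub hq).1
      rw [this]; noncomm_ring
    have h1 : ‖g (y * (1 - q))‖ ≤ Real.sqrt γ * ‖(y : H →L[ℂ] H)‖ * δ := by
      refine le_of_sq_le_sq ?_ (by positivity)
      have := hg.norm_map_star_mul_sq_le (star y) (1 - q)
      rw [star_star, mul_comm (g _).re] at this
      have h2 := hcs (star y) (norm_star (y : H →L[ℂ] H)).le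
      rw [star_star] at h2
      exact this.trans h2
    have h2 : ‖g (star (1 - q) * (y * q))‖ ≤ Real.sqrt γ * ‖(y : H →L[ℂ] H)‖ * δ := by
      refine le_of_sq_le_sq ?_ (by positivity)
      refine (hg.norm_map_star_mul_sq_le (1 - q) (y * q)).trans (hcs (y * q) ?_)
      exact (norm_mul_le (y : H →L[ℂ] H) q).trans
        (mul_le_of_le_one_right (norm_nonneg _) hq.norm_le_one)
    have h3 : ‖g (q * y * q)‖ ≤ γ * δ := by
      refine (hg.norm_map_le _).trans ?_
      gcongr
      exact hqδ.le
    calc ‖g y‖ = ‖g (y * (1 - q)) + g (star (1 - q) * (y * q)) + g (q * y * q)‖ := by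
          rw [← map_add, ← map_add, ← hdec]
      _ ≤ _ := norm_add₃_le
      _ ≤ K * δ := by rw [hK]; linarith
  refine norm_le_zero_iff.1 (le_of_forall_pos_le_add fun ε hε => ?_)
  refine (hbound (ε / (K + 1)) (by positivity)).trans ?_
  rw [zero_add, ← mul_div_assoc, div_le_iff₀ (by positivity)]
  nlinarith

theorem isSingularOn_of_decides (hF : IsGood N F) (hf : ∀ x : ↥N, Decides F x (f x))
    {e : ℕ → H →L[ℂ] H} (he : ∀ n, e n ∈ nonzeroProj N)
    (hlim : ∀ ξ, Tendsto (fun n => e n ξ) atTop (𝓝 0))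
    (heF : ∀ n, ∀ ε > 0, nearBelow N (e n) ε ∈ F) : IsSingularOn N f := by
  intro g hg hfg hnorm
  have heq : ∀ n, g ⟨e n, (he n).1⟩ = g 1 := by
    intro n
    set q : ↥N := ⟨e n, (he n).1⟩ with hq
    have hqp : IsProjection (q : H →L[ℂ] H) := (he n).2.1
    have hf0 : (f (1 - q)).re ≤ 0 := by
      refine le_of_forall_pos_le_add fun ε hε => ?_
      have := re_map_one_sub_le hF hf hqp (heF n (Real.sqrt ε) (Real.sqrt_pos.2 hε))
      rwa [Real.sq_sqrt hε.le, ← zero_add ε] at this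
    have h1 := hfg.re_nonneg (1 - q)
    have h2 := hg.re_nonneg (1 - q)
    have h3 := hg.im_eq_zero (1 - q)
    rw [star_mul_self_of_isProjection (isProjection_coe_one_sub hqp)] at h1 h2 h3
    rw [LinearMap.sub_apply, Complex.sub_re] at h1
    have h4 : g (1 - q) = 0 := Complex.ext (le_antisymm (by linarith [Complex.zero_re]) h2) h3
    rw [map_sub, sub_eq_zero] at h4
    exact h4.symm
  have ht : Tendsto (fun n => (⟨e n, (he n).1⟩ : ↥N)) atTop
      (@nhds ↥N (TopologicalSpace.induced (fun x : ↥N => (x : H →L[ℂ] H)) (sigmaWeak H)) 0) := by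
    rw [@nhds_induced _ _ (sigmaWeak H), tendsto_comap_iff]
    exact tendsto_sigmaWeak_zero (fun n => (he n).2.1.norm_le_one) hlim
  have hg1 : g 1 = 0 := by
    have h := (@Continuous.tendsto _ _ (_) _ _ hnorm 0).comp ht
    rw [map_zero] at h
    exact tendsto_nhds_unique (tendsto_const_nhds.congr fun n => (heq n).symm) h
  refine LinearMap.ext fun x => ?_
  have := hg.norm_map_le x
  rw [hg1, Complex.zero_re, zero_mul] at this
  exact norm_le_zero_iff.1 this

end State

/-! ### Classical normality -/

/-- A set of pairwise orthogonal nonzero projections on a separable Hilbert space is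
countable. -/
theorem countable_of_pairwise_orthogonal [TopologicalSpace.SeparableSpace H]
    {S : Set (H →L[ℂ] H)} (hS : ∀ p ∈ S, IsProjection p ∧ p ≠ 0)
    (horth : S.Pairwise fun p q => p * q = 0) : S.Countable := by
  have hv : ∀ p : H →L[ℂ] H, ∃ ξ, p ∈ S → ‖ξ‖ = 1 ∧ p ξ = ξ := by
    intro p
    by_cases hp : p ∈ S
    · obtain ⟨ξ, hξ⟩ := (hS p hp).1.exists_unit (hS p hp).2
      exact ⟨ξ, fun _ => hξ⟩
    · exact ⟨0, fun h => absurd h hp⟩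
  choose v hv using hv
  refine Set.PairwiseDisjoint.countable_of_isOpen (s := fun p => Metric.ball (v p) (1 / 2))
    (fun p hp q hq hpq => ?_) (fun _ _ => Metric.isOpen_ball)
    fun p _ => ⟨v p, Metric.mem_ball_self (by norm_num)⟩
  refine Metric.ball_disjoint_ball ?_
  obtain ⟨hp1, hpv⟩ := hv p hp
  obtain ⟨-, hqv⟩ := hv q hq
  have h0 : p (v q) = 0 := by
    rw [← hqv, ← opMul_apply, horth hp hq hpq]; rfl
  have h1 : p (v p - v q) = v p := by rw [map_sub, hpv, h0, sub_zero]
  have h2 := (hS p hp).1.norm_apply_le (v p - v q)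
  rw [h1, hp1] at h2
  rw [dist_eq_norm]
  linarith

/-- A maximal orthogonal sequence in a set of projections. -/
theorem exists_maximal_orthogonal_seq [TopologicalSpace.SeparableSpace H]
    {Z : Set (H →L[ℂ] H)} (hZ : ∀ p ∈ Z, IsProjection p) :
    ∃ u : ℕ → H →L[ℂ] H, (∀ n, u n = 0 ∨ u n ∈ Z) ∧ (∀ n m, n ≠ m → u n * u m = 0) ∧
      ∀ r ∈ Z, (∀ n, r * u n = 0) → r = 0 := by
  obtain ⟨S, hS⟩ := zorn_subset
    {S : Set (H →L[ℂ] H) | (∀ p ∈ S, p ∈ Z ∧ p ≠ 0) ∧ S.Pairwise fun p q => p * q = 0} (by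
      intro c hc hchain
      refine ⟨⋃₀ c, ⟨?_, ?_⟩, fun s hs => Set.subset_sUnion_of_mem hs⟩
      · rintro p ⟨s, hs, hp⟩
        exact (hc hs).1 p hp
      · exact (Set.pairwise_sUnion hchain.directedOn).2 fun s hs => (hc hs).2)
  obtain ⟨⟨hSZ, horth⟩, hmax⟩ := hS
  have hcount := countable_of_pairwise_orthogonal
    (fun p hp => ⟨hZ p (hSZ p hp).1, (hSZ p hp).2⟩) horth
  have := hcount.toEncodable
  refine ⟨fun n => (Encodable.decode₂ S n).elim 0 Subtype.val, fun n => ?_, fun n m hnm => ?_,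
    fun r hr hru => ?_⟩
  · simp only
    rcases h : Encodable.decode₂ S n with _ | p
    · exact Or.inl rfl
    · exact Or.inr (hSZ p p.2).1
  · simp only
    rcases hn : Encodable.decode₂ S n with _ | p
    · simp
    · rcases hm : Encodable.decode₂ S m with _ | q
      · simp
      · refine horth p.2 q.2 fun hpq => hnm ?_
        rw [← Encodable.mem_decode₂.1 hn, ← Encodable.mem_decode₂.1 hm, Subtype.ext hpq]
  · by_contra hr0
    have hrS : ∀ p ∈ S, r * p = 0 := fun p hp => by
      have := hru (Encodable.encode (⟨p, hp⟩ : S))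
      simpa [Encodable.encodek₂] using this
    have hins : insert r S ∈ {S : Set (H →L[ℂ] H) | (∀ p ∈ S, p ∈ Z ∧ p ≠ 0) ∧
        S.Pairwise fun p q => p * q = 0} := by
      refine ⟨?_, ?_⟩
      · rintro p (rfl | hp)
        · exact ⟨hr, hr0⟩
        · exact hSZ p hp
      · refine horth.insert fun p hp _ => ⟨hrS p hp, ?_⟩
        simpa [(hZ r hr).1, (hZ p (hSZ p hp).1).1] using congrArg star (hrS p hp)
    have hmem : r ∈ S := hmax hins (Set.subset_insert r S) (Set.mem_insert r S)
    exact hr0 (by rw [← (hZ r hr).2, hrS r hmem])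

/-- The partial sums of an orthogonal sequence of projections. -/
theorem isProjection_sum_range {u : ℕ → H →L[ℂ] H} (hu : ∀ n, IsProjection (u n))
    (horth : ∀ n m, n ≠ m → u n * u m = 0) :
    (∀ n, IsProjection (∑ i ∈ Finset.range n, u i)) ∧
      (∀ n m, n ≤ m → (∑ i ∈ Finset.range n, u i) * ∑ i ∈ Finset.range m, u i =
        ∑ i ∈ Finset.range n, u i) ∧
      ∀ n, u n * ∑ i ∈ Finset.range (n + 1), u i = u n := by
  have hzero : ∀ n m, n ≤ m → (∑ i ∈ Finset.range n, u i) * u m = 0 := by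
    intro n m h
    rw [Finset.sum_mul]
    exact Finset.sum_eq_zero fun i hi =>
      horth i m ((Finset.mem_range.1 hi).trans_le h).ne
  have hproj : ∀ n, IsProjection (∑ i ∈ Finset.range n, u i) := by
    intro n
    induction n with
    | zero => simpa using IsProjection.zero
    | succ n ih =>
      rw [Finset.sum_range_succ]
      exact ih.add (hu n) (hzero n n le_rfl)
  refine ⟨hproj, fun n m h => ?_, fun n => ?_⟩
  · induction m, h using Nat.le_induction with
    | base => exact (hproj n).2
    | succ m h ih => rw [Finset.sum_range_succ, mul_add, ih, hzero n m h, add_zero]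
  · rw [Finset.sum_range_succ, mul_add, (hu n).2, Finset.mul_sum,
      Finset.sum_eq_zero fun i hi => horth n i (Finset.mem_range.1 hi).ne', zero_add]

/-- A state given by a minimal projection of `C` is normal on `C`. -/
theorem isNormalOnSub_of_minimal {N : VonNeumannAlgebra H} {f : ↥N →ₗ[ℂ] ℂ}
    {C : VonNeumannAlgebra H} (hC : (C : Set (H →L[ℂ] H)) ⊆ N)
    (hmul : IsMultiplicativeOn N f (C : Set (H →L[ℂ] H))) {q : ↥N}
    (hq : IsMinimalProjectionIn (C : Set (H →L[ℂ] H)) q) (hfq : f q = 1) :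
    IsNormalOnSub N f C hC := by
  obtain ⟨ξ, hξ, hqξ⟩ := hq.2.1.exists_unit hq.2.2.1
  have hval : (fun x : ↥C => f ⟨x, hC x.2⟩) = fun x : ↥C => ⟪ξ, (x : H →L[ℂ] H) ξ⟫_ℂ := by
    funext x
    obtain ⟨c, hc⟩ := exists_eq_smul_of_minimal C hq x.2
    set y : ↥N := ⟨x, hC x.2⟩ with hy
    have h1 : q * y * q = c • q := Subtype.ext hc
    have h2 := congrArg f h1
    rw [hmul _ _ (mul_mem (S := VonNeumannAlgebra H) hq.1 x.2) hq.1, hmul _ _ hq.1 x.2, map_smul,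
      hfq, one_mul, mul_one, smul_eq_mul, mul_one] at h2
    rw [h2]
    have h3 := congrArg (fun z : H →L[ℂ] H => ⟪ξ, z ξ⟫_ℂ) hc
    simp only [opMul_apply, hqξ] at h3
    rw [← hq.2.1.inner_apply, hqξ] at h3
    rw [h3]
    simp [hqξ, hξ]
  rw [IsNormalOnSub, hval]
  exact @Continuous.comp _ _ _ (_) (sigmaWeak H) _ _ _ (continuous_sigmaWeak_inner ξ ξ)
    continuous_induced_dom

/-- A state taking the value `0` or `1` at a projection vanishes on the operators that are
off-diagonal with respect to it. -/
theorem IsPosFunctional.map_eq_zero_of_offDiagonal {N : VonNeumannAlgebra H} {f : ↥N →ₗ[ℂ] ℂ}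
    (hpos : IsPosFunctional N f) (hf1 : f 1 = 1) {p x : ↥N} (hp : IsProjection (p : H →L[ℂ] H))
    (hfp : f p = 0 ∨ f p = 1) (hx1 : p * x * p = 0) (hx2 : (1 - p) * x * (1 - p) = 0) :
    f x = 0 := by
  have hdx : x = p * x * (1 - p) + (1 - p) * x * p := by
    have : x = p * x * p + p * x * (1 - p) + (1 - p) * x * p + (1 - p) * x * (1 - p) := by
      noncomm_ring
    rwa [hx1, hx2, zero_add, add_zero] at this
  have hkill : ∀ a : ↥N, IsProjection (a : H →L[ℂ] H) → f a = 0 → ∀ b : ↥N,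
      f (a * b) = 0 ∧ f (b * a) = 0 := by
    intro a ha hfa b
    have hsa : star a = a := Subtype.ext ha.1
    have h0 : f (star a * a) = 0 := by rw [star_mul_self_of_isProjection ha, hfa]
    refine ⟨?_, hpos.map_mul_eq_zero h0 b⟩
    have := hpos.map_star_mul_eq_zero h0 b
    rwa [hsa] at this
  rw [hdx, map_add]
  rcases hfp with h | h
  · rw [mul_assoc, (hkill p hp h _).1, (hkill p hp h _).2, add_zero]
  · have h' : f (1 - p) = 0 := by rw [map_sub, hf1, h, sub_self]
    have hk := hkill (1 - p) (isProjection_coe_one_sub hp) h'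
    rw [(hk _).2, mul_assoc (1 - p), (hk _).1, add_zero]

theorem isClassicallyNormalOn_of_decides [TopologicalSpace.SeparableSpace H]
    {N : VonNeumannAlgebra H} {F : Filter (H →L[ℂ] H)} {f : ↥N →ₗ[ℂ] ℂ} (hF : IsGood N F)
    (hf : ∀ x : ↥N, Decides F x (f x)) (hset : ∀ P, IsExhaustion N P → Settles N F P) :
    IsClassicallyNormalOn N f := by
  intro C hC hmul
  obtain ⟨hpos, hf1⟩ := isStateOn_of_decides hF hf
  have h01 : ∀ p : ↥N, (p : H →L[ℂ] H) ∈ C → IsProjection (p : H →L[ℂ] H) →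
      f p = 0 ∨ f p = 1 := by
    intro p hpC hp
    have h := hmul p p hpC hpC
    rw [show p * p = p from Subtype.ext hp.2] at h
    by_cases h0 : f p = 0
    · exact Or.inl h0
    · exact Or.inr (mul_left_cancel₀ h0 (by rw [← h, mul_one]))
  set Z : Set (H →L[ℂ] H) := {p | IsProjection p ∧ ∃ hp : p ∈ C, f ⟨p, hC hp⟩ = 0} with hZ
  obtain ⟨u, huZ, horth, hmax⟩ := exists_maximal_orthogonal_seq (Z := Z) fun p hp => hp.1
  have hu : ∀ n, u n ∈ Z := fun n => (huZ n).elim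
    (fun h => h ▸ ⟨IsProjection.zero, zero_mem C, map_zero f⟩) id
  obtain ⟨htp, htm, hut⟩ := isProjection_sum_range (fun n => (hu n).1) horth
  set t : ℕ → H →L[ℂ] H := fun n => ∑ i ∈ Finset.range n, u i with ht
  have htC : ∀ n, t n ∈ C := fun n => sum_mem fun i _ => (hu i).2.1
  have hft : ∀ n, f ⟨t n, hC (htC n)⟩ = 0 := by
    intro n
    have h : (⟨t n, hC (htC n)⟩ : ↥N) =
        ∑ i ∈ Finset.range n, (⟨u i, hC (hu i).2.1⟩ : ↥N) := by
      refine Subtype.ext ?_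
      rw [AddSubmonoidClass.coe_finsetSum]
    rw [h, map_sum]
    exact Finset.sum_eq_zero fun i _ => (hu i).2.2
  obtain ⟨T, hTp, hTmem, hTt, htT, hlim⟩ := exists_strong_limit htp htm
  have hTC : T ∈ C := hTmem C htC
  set e : ↥N := ⟨T, hC hTC⟩ with he
  have hsub : ((1 - e : ↥N) : H →L[ℂ] H) = 1 - T := rfl
  have hqC : ((1 - e : ↥N) : H →L[ℂ] H) ∈ C := sub_mem (one_mem C) hTC
  have hmaxT : ∀ r ∈ Z, r * T = 0 → r = 0 := by
    intro r hr hrT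
    refine hmax r hr fun n => ?_
    have h : T * u n = u n := by
      have h1 := congrArg star (hut n)
      rw [star_mul, (hu n).1.1, (htp (n + 1)).1] at h1
      rw [← h1, ← mul_assoc, hTt (n + 1)]
    rw [← h, ← mul_assoc, hrT, zero_mul]
  rcases h01 e hTC hTp with h0 | h1
  · have hfq : f (1 - e) = 1 := by rw [map_sub, hf1, h0, sub_zero]
    refine isNormalOnSub_of_minimal hC hmul (q := 1 - e) ⟨hqC, isProjection_coe_one_sub hTp, ?_, ?_⟩
      hfq
    · intro h
      have : (1 - e : ↥N) = 0 := Subtype.ext h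
      rw [this, map_zero] at hfq
      exact zero_ne_one hfq
    · intro r hrC hrp ⟨hr1, hr2⟩
      rw [hsub] at hr1 hr2 ⊢
      have hrT : r * T = 0 := by
        rw [mul_sub, mul_one, sub_eq_self] at hr1
        exact hr1
      rcases h01 ⟨r, hC hrC⟩ hrC hrp with hr0 | hr1'
      · exact Or.inl (hmaxT r ⟨hrp, hrC, hr0⟩ hrT)
      · refine Or.inr (sub_eq_zero.1 (hmaxT (1 - T - r) ⟨?_, sub_mem hqC hrC, ?_⟩ ?_)).symm
        · exact hTp.one_sub.sub hrp hr1 hr2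
        · change f ((1 - e) - ⟨r, hC hrC⟩) = 0
          rw [map_sub, hfq, hr1', sub_self]
        · rw [sub_mul, sub_mul, one_mul, hTp.2, hrT, sub_self, sub_zero]
  · exfalso
    have hTt0 : ∀ n, (1 - T) * t n = 0 := fun n => by rw [sub_mul, one_mul, hTt, sub_self]
    have htT0 : ∀ n, t n * (1 - T) = 0 := fun n => by rw [mul_sub, mul_one, htT, sub_self]
    have hPC : ∀ n, 1 - T + t n ∈ C := fun n => add_mem hqC (htC n)
    have hP : IsExhaustion N fun n => 1 - T + t n := by
      refine ⟨fun n => hC (hPC n), fun n => hTp.one_sub.add (htp n) (hTt0 n), fun n m h => ?_,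
        fun ξ => ?_⟩
      · have := htm n m h
        rw [add_mul, mul_add, mul_add, hTp.one_sub.2, hTt0, htT0]
        simpa using this
      · have := (tendsto_const_nhds (x := (1 - T) ξ)).add (hlim ξ)
        have h2 : (1 - T) ξ + T ξ = ξ := by simp
        rw [h2] at this
        exact this
    rcases hset _ hP with ⟨n, l, hl, hdec⟩ | ⟨p, x, hp, hpC, hxN, hx1, hx2, l, hl, hdec⟩
    · have hval := hf ((1 - e) + ⟨t n, hC (htC n)⟩)
      have hcoe : (((1 - e) + ⟨t n, hC (htC n)⟩ : ↥N) : H →L[ℂ] H) = 1 - T + t n := rfl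
      rw [hcoe] at hval
      have h := hval.unique hF hdec
      rw [map_add, map_sub, hf1, h1, hft, sub_self, add_zero] at h
      exact hl.ne (by exact_mod_cast h)
    · have hpC' := hpC C hPC
      lift x to ↥N using hxN
      have hfx : f x = 0 := hpos.map_eq_zero_of_offDiagonal hf1 (p := ⟨p, hC hpC'⟩) hp
        (h01 _ hpC' hp) (Subtype.ext hx1) (Subtype.ext hx2)
      have h := (hf x).unique hF hdec
      rw [hfx] at h
      exact hl.ne (by exact_mod_cast h)

/-- Assuming the continuum hypothesis, every infinite-dimensional factor acting on a
separable Hilbert space admits a classically normal, singular pure state. -/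
theorem exists_classically_normal_singular_pure_state
    (CH : (2 : Cardinal.{0}) ^ Cardinal.aleph0 = Cardinal.aleph 1)
    [TopologicalSpace.SeparableSpace H]
    (N : VonNeumannAlgebra H) (hfac : IsFactor N) (hinf : ¬ FiniteDimensional ℂ ↥N) :
    ∃ f : ↥N →ₗ[ℂ] ℂ,
      IsPureStateOn N f ∧ IsSingularOn N f ∧ IsClassicallyNormalOn N f := by
  obtain ⟨F, hF, hFc, e, he, hlim, heF⟩ := exists_good_base N hinf
  obtain ⟨G, hGF, hG, hdec, hset⟩ := hF.exists_complete_refinement CH hfac hFc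
  obtain ⟨f, hf⟩ := hG.exists_functional hdec
  exact ⟨f, isPureStateOn_of_decides hG hf,
    isSingularOn_of_decides hG hf he hlim fun n ε hε => hGF (heF n ε hε),
    isClassicallyNormalOn_of_decides hG hf hset⟩
end

section
/- Let f be a classically normal, singular pure state on a von Neumann algebra N. Then f is not multiplicative on any MASA of N. -/
open scoped ComplexOrder InnerProductSpace
open Filter Topology

variable {H : Type*} [NormedAddCommGroup H] [InnerProductSpace ℂ H] [CompleteSpace H]

/-- `A` is a MASA of the von Neumann algebra `N`: a maximal abelian self-adjoint
subalgebra of `N`. -/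
def IsMasaIn (N : VonNeumannAlgebra H) (A : StarSubalgebra ℂ (H →L[ℂ] H)) : Prop :=
  (A : Set (H →L[ℂ] H)) ⊆ N ∧ (∀ x ∈ A, ∀ y ∈ A, x * y = y * x) ∧
    ∀ A' : StarSubalgebra ℂ (H →L[ℂ] H), (A' : Set (H →L[ℂ] H)) ⊆ N →
      (∀ x ∈ A', ∀ y ∈ A', x * y = y * x) → A ≤ A' → A' = A

/-- Inflation of an operator on `E` to a diagonal operator on the Hilbert sum of copies of `E`
indexed by `ι`. -/
noncomputable def inflate (ι E : Type*) [NormedAddCommGroup E] [InnerProductSpace ℂ E]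
    [CompleteSpace E] :
    (E →L[ℂ] E) →⋆ₐ[ℂ] (lp (fun _ : ι => E) 2 →L[ℂ] lp (fun _ : ι => E) 2) where
  toFun x := lp.mapCLM 2 (fun _ => x) (norm_nonneg x) (fun _ => le_rfl)
  map_one' := by ext; rfl
  map_mul' _ _ := by ext; rfl
  map_zero' := by ext; rfl
  map_add' _ _ := by ext; rfl
  commutes' _ := by ext; rfl
  map_star' x := by
    rw [ContinuousLinearMap.star_eq_adjoint, ContinuousLinearMap.star_eq_adjoint,
      ContinuousLinearMap.eq_adjoint_iff]
    intro v w
    simp only [lp.inner_eq_tsum]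
    exact tsum_congr fun i => ContinuousLinearMap.adjoint_inner_left x (w i) (v i)

theorem inflate_apply {ι E : Type*} [NormedAddCommGroup E] [InnerProductSpace ℂ E]
    [CompleteSpace E] (x : E →L[ℂ] E) (v : lp (fun _ : ι => E) 2) (i : ι) :
    inflate ι E x v i = x (v i) :=
  rfl

/-- If `⟪ξ, π k η⟫` vanishes for all `k` in a self-adjoint algebra `K` of operators but
`⟪ξ, η⟫` does not, then `π K` has a nonzero common null vector. -/
theorem exists_common_null_vector {E : Type*} [NormedAddCommGroup E] [InnerProductSpace ℂ E]
    [CompleteSpace E] (π : (H →L[ℂ] H) →⋆ₐ[ℂ] (E →L[ℂ] E))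
    (K : NonUnitalStarSubalgebra ℂ (H →L[ℂ] H)) (ξ η : E)
    (hK : ∀ k ∈ K, ⟪ξ, π k η⟫_ℂ = 0) (h : ⟪ξ, η⟫_ℂ ≠ 0) :
    ∃ ζ : E, ζ ≠ 0 ∧ ∀ k ∈ K, π k ζ = 0 := by
  let W₀ : Submodule ℂ E :=
    { carrier := {v | ∃ k ∈ K, π k η = v}
      add_mem' := by
        rintro _ _ ⟨k, hk, rfl⟩ ⟨l, hl, rfl⟩
        exact ⟨k + l, add_mem hk hl, by simp⟩
      zero_mem' := ⟨0, zero_mem K, by simp⟩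
      smul_mem' := by
        rintro c _ ⟨k, hk, rfl⟩
        exact ⟨c • k, SMulMemClass.smul_mem c hk, by simp⟩ }
  let W := W₀.topologicalClosure
  have : CompleteSpace W := W₀.isClosed_topologicalClosure.completeSpace_coe
  have hξ : ξ ∈ Wᗮ := by
    rw [Submodule.orthogonal_closure, Submodule.mem_orthogonal']
    rintro _ ⟨k, hk, rfl⟩
    exact hK k hk
  have hinv : ∀ k ∈ K, ∀ w ∈ W, π k w ∈ W := by
    intro k hk w hw
    refine map_mem_closure (π k).continuous hw ?_
    rintro _ ⟨l, hl, rfl⟩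
    exact ⟨k * l, mul_mem hk hl, by simp⟩
  have hη : ∀ k ∈ K, π k η ∈ W := fun k hk => W₀.le_topologicalClosure ⟨k, hk, rfl⟩
  have hζ : η - W.starProjection η ∈ Wᗮ := W.sub_starProjection_mem_orthogonal η
  refine ⟨η - W.starProjection η, fun h0 => h ?_, fun k hk => ?_⟩
  · rw [sub_eq_zero.mp h0]
    exact Submodule.inner_left_of_mem_orthogonal (W.starProjection_apply_mem η) hξ
  · have h1 : π k (η - W.starProjection η) ∈ W := by
      rw [map_sub]
      exact sub_mem (hη k hk) (hinv k hk _ (W.starProjection_apply_mem η))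
    have h2 : π k (η - W.starProjection η) ∈ Wᗮ := by
      rw [Submodule.mem_orthogonal]
      intro w hw
      rw [← ContinuousLinearMap.adjoint_inner_left, ← ContinuousLinearMap.star_eq_adjoint,
        ← map_star]
      exact Submodule.inner_right_of_mem_orthogonal (hinv _ (star_mem hk) w hw) hζ
    exact inner_self_eq_zero.mp (Submodule.inner_right_of_mem_orthogonal h1 h2)

/-- The σ-weakly continuous functional `x ↦ ∑ ⟪ξ n, x (η n)⟫`. -/
noncomputable def sigmaWeakFunctional (ξ η : lp (fun _ : ℕ => H) 2) : (H →L[ℂ] H) →ₗ[ℂ] ℂ where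
  toFun x := ⟪ξ, inflate ℕ H x η⟫_ℂ
  map_add' x y := by simp
  map_smul' c x := by simp

/-- The σ-weak topology is induced by the functionals `sigmaWeakFunctional ξ η`. -/
theorem sigmaWeak_eq_iInf : sigmaWeak H = ⨅ p : lp (fun _ : ℕ => H) 2 × lp (fun _ : ℕ => H) 2,
    TopologicalSpace.induced (sigmaWeakFunctional p.1 p.2) inferInstance := by
  have hmem : ∀ ξ : ℕ → H, Memℓp ξ 2 ↔ Summable fun n => ‖ξ n‖ ^ 2 := by
    intro ξ
    rw [memℓp_gen_iff (by norm_num)]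
    simp
  have hfun : ∀ ξ η : lp (fun _ : ℕ => H) 2, (fun x : H →L[ℂ] H => ∑' n, ⟪ξ n, x (η n)⟫_ℂ) =
      sigmaWeakFunctional ξ η := by
    intro ξ η
    funext x
    exact (lp.inner_eq_tsum ξ (inflate ℕ H x η)).symm
  apply le_antisymm
  · refine le_iInf fun p => ?_
    rw [← hfun]
    exact iInf_le_of_le _ (iInf_le_of_le _ (iInf_le_of_le ((hmem _).1 p.1.2)
      (iInf_le_of_le ((hmem _).1 p.2.2) le_rfl)))
  · refine le_iInf fun ξ => le_iInf fun η => le_iInf fun hξ => le_iInf fun hη => ?_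
    refine (iInf_le _ (⟨ξ, (hmem ξ).2 hξ⟩, ⟨η, (hmem η).2 hη⟩)).trans ?_
    rw [← hfun]

/-- If a normal functional with `g 1 = 1` vanishes on a self-adjoint algebra `K` of operators,
then `K` has a nonzero common null vector. -/
theorem exists_ne_zero_forall_apply_eq_zero (C : VonNeumannAlgebra H) (g : ↥C →ₗ[ℂ] ℂ)
    (hg : IsNormalOn C g) (h1 : g 1 = 1) (K : NonUnitalStarSubalgebra ℂ (H →L[ℂ] H))
    (hK : ∀ k ∈ K, ∃ h : k ∈ C, g ⟨k, h⟩ = 0) :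
    ∃ v : H, v ≠ 0 ∧ ∀ k ∈ K, k v = 0 := by
  let ι := lp (fun _ : ℕ => H) 2 × lp (fun _ : ℕ => H) 2
  let incl : ↥C →ₗ[ℂ] (H →L[ℂ] H) :=
    { toFun := fun x => x, map_add' := fun _ _ => rfl, map_smul' := fun _ _ => rfl }
  let φ : ι → ↥C →ₗ[ℂ] ℂ := fun p => sigmaWeakFunctional p.1 p.2 ∘ₗ incl
  have hspan : g ∈ Submodule.span ℂ (Set.range φ) := by
    rw [LinearMap.mem_span_iff_continuous]
    unfold IsNormalOn at hg
    rw [sigmaWeak_eq_iInf, induced_iInf] at hg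
    refine (congrArg (fun t => @Continuous ↥C ℂ t _ g) (iInf_congr fun p => ?_)).mp hg
    exact induced_compose
  obtain ⟨a, ha⟩ := Finsupp.mem_span_range_iff_exists_finsupp.1 hspan
  let ξ : lp (fun _ : a.support => lp (fun _ : ℕ => H) 2) 2 :=
    ⟨fun p => star (a p) • p.1.1, Memℓp.all _⟩
  let η : lp (fun _ : a.support => lp (fun _ : ℕ => H) 2) 2 := ⟨fun p => p.1.2, Memℓp.all _⟩
  let π := (inflate a.support (lp (fun _ : ℕ => H) 2)).comp (inflate ℕ H)
  have hrep : ∀ x : ↥C, g x = ⟪ξ, π x η⟫_ℂ := by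
    intro x
    rw [lp.inner_eq_tsum, tsum_fintype, ← ha, Finsupp.sum, LinearMap.sum_apply,
      ← Finset.sum_coe_sort]
    refine Finset.sum_congr rfl fun p _ => ?_
    change a p * _ = ⟪star (a p) • p.1.1, _⟫_ℂ
    rw [inner_smul_left]
    simp only [RCLike.star_def, RCLike.conj_conj]
    rfl
  obtain ⟨ζ, hζ, hζK⟩ := exists_common_null_vector π K ξ η
    (fun k hk => by obtain ⟨hC, h0⟩ := hK k hk; rw [← h0, hrep])
    (by
      have := hrep 1
      rw [h1] at this
      have h2 : π ((1 : ↥C) : H →L[ℂ] H) = 1 := map_one π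
      rw [h2] at this
      exact fun h => one_ne_zero (this.trans h))
  by_contra! hcon
  refine hζ (lp.ext <| funext fun p => lp.ext <| funext fun n => ?_)
  by_contra hne
  obtain ⟨k, hk, hkn⟩ := hcon (ζ p n) hne
  refine hkn ?_
  have := congrArg (fun v : lp (fun _ : a.support => lp (fun _ : ℕ => H) 2) 2 => v p n) (hζK k hk)
  exact this

/-- A positive functional vanishing on `star b * b` vanishes on all `star a * b` and
`star b * a`. -/
theorem IsPosFunctional.apply_mul_eq_zero {M : VonNeumannAlgebra H} {f : ↥M →ₗ[ℂ] ℂ}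
    (hf : IsPosFunctional M f) {b : ↥M} (hb : f (star b * b) = 0) (a : ↥M) :
    f (star a * b) = 0 ∧ f (star b * a) = 0 := by
  set u := f (star a * b)
  set v := f (star b * a)
  set w := f (star a * a)
  have key : ∀ z : ℂ, 0 ≤ z * v + star z * u + star z * z * w := by
    intro z
    have h := hf (b + z • a)
    have e : star (b + z • a) * (b + z • a) =
        star b * b + z • (star b * a) + star z • (star a * b) + (star z * z) • (star a * a) := by
      have hs : star (z • a) = star z • star a := Subtype.ext (star_smul z (a : H →L[ℂ] H))
      have h1 : ∀ (c : ℂ) (x y : ↥M), (c • x) * y = c • (x * y) :=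
        fun c x y => Subtype.ext (smul_mul_assoc c (x : H →L[ℂ] H) y)
      have h2 : ∀ (c : ℂ) (x y : ↥M), x * (c • y) = c • (x * y) :=
        fun c x y => Subtype.ext (mul_smul_comm c (x : H →L[ℂ] H) y)
      rw [star_add, hs, add_mul, mul_add, mul_add, h1, h1, h2, h2, smul_smul]
      abel
    rw [e, map_add, map_add, map_add, map_smul, map_smul, map_smul, hb, zero_add] at h
    exact h
  have hw := hf a
  have hwi : w.im = 0 := (Complex.le_def.1 hw).2.symm
  have k (z : ℂ) := Complex.le_def.1 (key z)
  simp only [Complex.star_def, Complex.add_re, Complex.add_im, Complex.mul_re, Complex.mul_im,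
    Complex.conj_re, Complex.conj_im, Complex.zero_re, Complex.zero_im, hwi] at k
  have lin : ∀ r s : ℝ, (∀ t : ℝ, 0 ≤ t * r + t * t * s) → r = 0 := by
    intro r s h
    by_contra hr
    have hs : 0 < 1 + |s| := by positivity
    have h1 := h (-r / (1 + |s|))
    have h2 : -r / (1 + |s|) * r + -r / (1 + |s|) * (-r / (1 + |s|)) * s
        = r ^ 2 / (1 + |s|) ^ 2 * (s - (1 + |s|)) := by
      field_simp
      ring
    rw [h2] at h1
    have h3 : 0 < r ^ 2 / (1 + |s|) ^ 2 := by positivity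
    nlinarith [le_abs_self s]
  have r1 : v.re + u.re = 0 := lin _ w.re fun t => by
    have := (k (t : ℂ)).1
    simp at this
    linarith
  have r2 : u.im - v.im = 0 := lin _ w.re fun t => by
    have := (k (t * Complex.I)).1
    simp at this
    linarith
  have i1 := (k 1).2
  have i2 := (k Complex.I).2
  simp at i1 i2
  constructor <;> apply Complex.ext <;> simp <;> linarith

/-- A MASA of `N` contains the double commutant of every commuting self-adjoint subset of `N`
containing it. -/
theorem IsMasaIn.centralizer_centralizer_subset {N : VonNeumannAlgebra H}
    {A : StarSubalgebra ℂ (H →L[ℂ] H)} (hA : IsMasaIn N A) {S : Set (H →L[ℂ] H)}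
    (hAS : (A : Set (H →L[ℂ] H)) ⊆ S) (hSN : S ⊆ N) (hstar : star S = S)
    (hcomm : ∀ x ∈ S, ∀ y ∈ S, x * y = y * x) :
    S.centralizer.centralizer ⊆ A := by
  let B : StarSubalgebra ℂ (H →L[ℂ] H) :=
    StarSubalgebra.centralizer ℂ (StarSubalgebra.centralizer ℂ S : Set (H →L[ℂ] H))
  have hB : (B : Set (H →L[ℂ] H)) = S.centralizer.centralizer := by
    rw [StarSubalgebra.coe_centralizer_centralizer, hstar, Set.union_self]
  have hSS : S ⊆ S.centralizer := fun x hx y hy => hcomm y hy x hx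
  have hBA : B = A := by
    refine hA.2.2 B ?_ ?_ ?_
    · rw [hB, ← N.centralizer_centralizer]
      exact Set.centralizer_subset (Set.centralizer_subset hSN)
    · intro x hx y hy
      rw [← SetLike.mem_coe, hB] at hx hy
      exact (hx y (Set.centralizer_subset hSS hy)).symm
    · rw [← SetLike.coe_subset_coe, hB]
      exact hAS.trans Set.subset_centralizer_centralizer
  rw [← hB, hBA]

/-- A MASA of a von Neumann algebra is a von Neumann algebra. -/
theorem IsMasaIn.centralizer_centralizer {N : VonNeumannAlgebra H}
    {A : StarSubalgebra ℂ (H →L[ℂ] H)} (hA : IsMasaIn N A) :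
    Set.centralizer (Set.centralizer (A : Set (H →L[ℂ] H))) = A :=
  (hA.centralizer_centralizer_subset subset_rfl hA.1 (StarMemClass.star_coe_eq A)
    hA.2.1).antisymm Set.subset_centralizer_centralizer

/-- A MASA contains every self-adjoint element of the ambient algebra commuting with it. -/
theorem IsMasaIn.mem_of_isSelfAdjoint {N : VonNeumannAlgebra H}
    {A : StarSubalgebra ℂ (H →L[ℂ] H)} (hA : IsMasaIn N A) {x : H →L[ℂ] H} (hxN : x ∈ N)
    (hx : IsSelfAdjoint x) (hcomm : ∀ a ∈ A, a * x = x * a) : x ∈ A := by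
  refine hA.centralizer_centralizer_subset (S := insert x A) (Set.subset_insert _ _)
    (Set.insert_subset hxN hA.1) ?_ ?_ (Set.subset_centralizer_centralizer (Set.mem_insert _ _))
  · rw [← Set.image_star, Set.image_insert_eq, Set.image_star, hx.star_eq,
      StarMemClass.star_coe_eq]
  · rintro y (rfl | hy) z (rfl | hz)
    · rfl
    · exact (hcomm z hz).symm
    · exact hcomm y hy
    · exact hA.2.1 y hy z hz

/-- Vector functionals are normal. -/
theorem isNormalOn_of_eq_inner {M : VonNeumannAlgebra H} {f : ↥M →ₗ[ℂ] ℂ} (v : H)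
    (hf : ∀ a : ↥M, f a = ⟪v, (a : H →L[ℂ] H) v⟫_ℂ) : IsNormalOn M f := by
  unfold IsNormalOn
  rw [continuous_iff_le_induced, sigmaWeak_eq_iInf, induced_iInf]
  let w : lp (fun _ : ℕ => H) 2 := lp.single 2 0 v
  refine iInf_le_of_le (w, w) ?_
  rw [induced_compose]
  refine le_of_eq (congrArg (TopologicalSpace.induced · _) (funext fun a => ?_))
  change ⟪w, inflate ℕ H (a : H →L[ℂ] H) w⟫_ℂ = f a
  rw [lp.inner_single_left, inflate_apply, lp.single_apply_self, hf]

/-- A classically normal, singular pure state on a von Neumann algebra `N` is not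
multiplicative on any MASA of `N`. -/
theorem classically_normal_not_multiplicative_on_masa
    (N : VonNeumannAlgebra H) (f : ↥N →ₗ[ℂ] ℂ)
    (hf : IsPureStateOn N f) (hsing : IsSingularOn N f) (hcn : IsClassicallyNormalOn N f)
    (A : StarSubalgebra ℂ (H →L[ℂ] H)) (hA : IsMasaIn N A) :
    ¬ IsMultiplicativeOn N f (A : Set (H →L[ℂ] H)) := by
  intro hmul
  obtain ⟨⟨hpos, hf1⟩, -⟩ := hf
  let C : VonNeumannAlgebra H := ⟨A, hA.centralizer_centralizer⟩
  have hC : (C : Set (H →L[ℂ] H)) ⊆ N := hA.1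
  let g : ↥C →ₗ[ℂ] ℂ :=
    { toFun := fun x => f ⟨x, hC x.2⟩
      map_add' := fun x y => map_add f ⟨x, hC x.2⟩ ⟨y, hC y.2⟩
      map_smul' := fun c x => map_smul f c ⟨x, hC x.2⟩ }
  let K : NonUnitalStarSubalgebra ℂ (H →L[ℂ] H) :=
    { carrier := {k | ∃ h : k ∈ A, f ⟨k, hC h⟩ = 0}
      add_mem' := by
        rintro x y ⟨hx, hx0⟩ ⟨hy, hy0⟩
        refine ⟨add_mem hx hy, ?_⟩
        have := map_add f ⟨x, hC hx⟩ ⟨y, hC hy⟩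
        rwa [hx0, hy0, add_zero] at this
      zero_mem' := ⟨zero_mem A, map_zero f⟩
      mul_mem' := by
        rintro x y ⟨hx, hx0⟩ ⟨hy, hy0⟩
        refine ⟨mul_mem hx hy, ?_⟩
        have := hmul ⟨x, hC hx⟩ ⟨y, hC hy⟩ hx hy
        rwa [hx0, zero_mul] at this
      smul_mem' := by
        rintro c x ⟨hx, hx0⟩
        refine ⟨A.smul_mem hx c, ?_⟩
        have := map_smul f c ⟨x, hC hx⟩
        rwa [hx0, smul_zero] at this
      star_mem' := by
        rintro x ⟨hx, hx0⟩
        refine ⟨star_mem hx, ?_⟩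
        have h0 : f (star ⟨x, hC hx⟩ * ⟨x, hC hx⟩) = 0 := by
          rw [hmul _ _ (star_mem hx) hx, hx0, mul_zero]
        have := (hpos.apply_mul_eq_zero h0 1).2
        rwa [mul_one] at this }
  obtain ⟨v₀, hv₀, hKv₀⟩ := exists_ne_zero_forall_apply_eq_zero C g (hcn C hC hmul) hf1 K
    fun _ hk => hk
  let V : Submodule ℂ H := ⨅ k ∈ K, k.ker
  have hV : ∀ w, w ∈ V ↔ ∀ k ∈ K, k w = 0 := by
    intro w
    simp [V, Submodule.mem_iInf]
  have hVclosed : IsClosed (V : Set H) := by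
    simp only [V, Submodule.coe_iInf]
    exact isClosed_iInter fun k => isClosed_iInter fun _ => k.isClosed_ker
  have : CompleteSpace V := hVclosed.completeSpace_coe
  obtain ⟨v, hvV, hv1⟩ : ∃ v ∈ V, ‖v‖ = 1 :=
    ⟨((‖v₀‖⁻¹ : ℝ) : ℂ) • v₀, V.smul_mem _ ((hV v₀).2 hKv₀), by simp [norm_smul, hv₀]⟩
  let p : H →L[ℂ] H := V.starProjection
  have hp : IsStarProjection p := isStarProjection_starProjection
  have hpp : p * p = p := hp.isIdempotentElem
  have hps : star p = p := hp.isSelfAdjoint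
  have hpv : p v = v := Submodule.starProjection_eq_self_iff.2 hvV
  have hpA : p ∈ A := by
    refine (VonNeumannAlgebra.IsStarProjection.mem_iff hp C).2 fun y hy => ?_
    have hr : p.range = V := V.range_starProjection
    rw [hr, Module.End.mem_invtSubmodule_iff_forall_mem_of_mem]
    intro w hw
    rw [hV] at hw ⊢
    intro k hk
    have hky : k * y = y * k := VonNeumannAlgebra.mem_commutant_iff.1 hy k hk.1
    change (k * y) w = 0
    rw [hky, mul_apply_eq_comp, hw k hk, map_zero]
  have hpN : p ∈ N := hC hpA
  have hcp : ∀ (c : H →L[ℂ] H) (hc : c ∈ A), c * p = f ⟨c, hC hc⟩ • p := by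
    intro c hc
    have hk : c - f ⟨c, hC hc⟩ • 1 ∈ K := by
      refine ⟨sub_mem hc (A.smul_mem (one_mem A) _), ?_⟩
      have := map_sub f ⟨c, hC hc⟩ (f ⟨c, hC hc⟩ • 1)
      rw [map_smul, hf1, smul_eq_mul, mul_one, sub_self] at this
      exact this
    ext w
    have := (hV (p w)).1 (V.starProjection_apply_mem w) _ hk
    simpa [sub_eq_zero] using this
  have hfp : f ⟨p, hpN⟩ = 1 := by
    have h := congrArg (fun x : H →L[ℂ] H => x v) (hcp p hpA)
    rw [hpp] at h
    simp only [smul_apply, hpv] at h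
    have hv0 : v ≠ 0 := by
      rintro rfl
      simp at hv1
    have : (1 : ℂ) • v = f ⟨p, hpN⟩ • v := by rw [one_smul]; exact h
    exact (smul_left_injective ℂ hv0 this).symm
  have hsa : ∀ x ∈ N, IsSelfAdjoint x → ∃ μ : ℂ, p * x * p = μ • p := by
    intro x hx hxs
    have hmem : p * x * p ∈ A := by
      refine hA.mem_of_isSelfAdjoint (mul_mem (mul_mem hpN hx) hpN) ?_ fun c hc => ?_
      · rw [IsSelfAdjoint, star_mul, star_mul, hps, hxs.star_eq, mul_assoc]
      · have hpc : p * c = f ⟨c, hC hc⟩ • p := by rw [hA.2.1 p hpA c hc, hcp c hc]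
        rw [mul_assoc (p * x), hpc, ← mul_assoc, ← mul_assoc, hcp c hc]
        simp only [smul_mul_assoc, mul_smul_comm]
    have h := hcp _ hmem
    rw [mul_assoc (p * x), hpp] at h
    exact ⟨_, h⟩
  have hcorner : ∀ x ∈ N, ∃ μ : ℂ, p * x * p = μ • p := by
    intro x hx
    have hre : (realPart x : H →L[ℂ] H) ∈ N := by
      rw [realPart_apply_coe, ← Complex.coe_smul]
      exact SMulMemClass.smul_mem _ (add_mem hx (star_mem hx))
    have him : (imaginaryPart x : H →L[ℂ] H) ∈ N := by
      rw [imaginaryPart_apply_coe, ← Complex.coe_smul]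
      exact SMulMemClass.smul_mem _ (SMulMemClass.smul_mem _ (sub_mem hx (star_mem hx)))
    obtain ⟨s, hs⟩ := hsa _ hre (realPart x).2
    obtain ⟨t, ht⟩ := hsa _ him (imaginaryPart x).2
    refine ⟨s + Complex.I * t, ?_⟩
    conv_lhs => rw [← realPart_add_I_smul_imaginaryPart x]
    rw [mul_add, add_mul, hs, mul_smul_comm, smul_mul_assoc, ht, add_smul, smul_smul]
  have hvec : ∀ a : ↥N, f a = ⟪v, (a : H →L[ℂ] H) v⟫_ℂ := by
    intro a
    obtain ⟨μ, hμ⟩ := hcorner a a.2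
    let P : ↥N := ⟨p, hpN⟩
    have hPP : P * P = P := Subtype.ext hpp
    have hPs : star P = P := Subtype.ext hps
    have hqs : star (1 - P) = 1 - P := by rw [star_sub, star_one, hPs]
    have hq : f (star (1 - P) * (1 - P)) = 0 := by
      rw [hqs, mul_sub, mul_one, sub_mul, one_mul, hPP, sub_self, sub_zero, map_sub, hf1, hfp,
        sub_self]
    have h1 := (hpos.apply_mul_eq_zero hq a).2
    have h2 := (hpos.apply_mul_eq_zero hq (star (P * a))).1
    rw [hqs] at h1
    rw [star_star] at h2
    have hdec : a = P * a * P + P * a * (1 - P) + (1 - P) * a := by noncomm_ring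
    have hPaP : P * a * P = μ • P := Subtype.ext hμ
    have hfa : f a = μ := by
      conv_lhs => rw [hdec]
      rw [map_add, map_add, h1, h2, hPaP, map_smul, hfp]
      simp
    have hin : ⟪v, (a : H →L[ℂ] H) v⟫_ℂ = ⟪v, (p * a * p) v⟫_ℂ := by
      conv_lhs => rw [← hpv]
      rw [← ContinuousLinearMap.adjoint_inner_right, ← ContinuousLinearMap.star_eq_adjoint, hps]
      rfl
    rw [hfa, hin, hμ, smul_apply, hpv, inner_smul_right,
      inner_self_eq_norm_sq_to_K, hv1]
    simp
  have hzero : f = 0 :=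
    hsing f hpos (fun a => by simp) (isNormalOn_of_eq_inner v hvec)
  rw [hzero] at hf1
  exact zero_ne_one hf1
end
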